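/- arXiv:1611.01424 — 5 statements merged into one kernel-verified Lean document; each statement's English description precedes it below -/
import Mathlib

section
/- Let n ≥ 2 and let w ∈ F_n be a non-trivial element. For any two sets S and S' each of cardinality at least 2, w is a C-test word with respect to the free group FreeGroup S if and only if w is a C-test word with respect to FreeGroup S'. In other words, whether w is a C-test word does not depend on the choice of the non-abelian free group F. -/
/-- `w` is a C-test word with respect to the free group `FreeGroup S`:
`w` is non-trivial, and for any two `n`-tuples of elements of `FreeGroup S` on which `w`
evaluates to the same non-trivial element, the tuples are conjugate. -/
def IsCTestWord (n : ℕ) (w : FreeGroup (Fin n)) (S : Type*) : Prop :=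
  w ≠ 1 ∧ ∀ A B : Fin n → FreeGroup S,
    FreeGroup.lift A w = FreeGroup.lift B w → FreeGroup.lift A w ≠ 1 →
      ∃ s : FreeGroup S, ∀ i : Fin n, s * A i * s⁻¹ = B i

theorem FreeGroup.subsingleton_of_forall_commute {α : Type*}
    (h : ∀ x y : FreeGroup α, Commute x y) : Subsingleton α := by
  classical
  refine ⟨fun a b => ?_⟩
  by_contra hab
  let f : α → Equiv.Perm (Fin 3) :=
    fun x => if x = a then Equiv.swap 0 1 else Equiv.swap 1 2
  have hf := (h (FreeGroup.of a) (FreeGroup.of b)).map (FreeGroup.lift f)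
  have hb : ¬ b = a := fun e => hab e.symm
  simp only [FreeGroup.lift_apply_of, f, if_true, if_neg hb] at hf
  exact absurd hf.eq (by decide)

theorem IsFreeGroup.isCyclic_of_forall_commute {G : Type*} [Group G] [IsFreeGroup G]
    (h : ∀ x y : G, Commute x y) : IsCyclic G := by
  let e := IsFreeGroup.toFreeGroup G
  have : Subsingleton (IsFreeGroup.Generators G) :=
    FreeGroup.subsingleton_of_forall_commute fun x y => by
      simpa using (h (e.symm x) (e.symm y)).map e
  have : IsCyclic (FreeGroup (IsFreeGroup.Generators G)) := by
    rcases isEmpty_or_nonempty (IsFreeGroup.Generators G) with _ | ⟨⟨a⟩⟩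
    · infer_instance
    · have : Unique (IsFreeGroup.Generators G) := uniqueOfSubsingleton a
      infer_instance
  exact isCyclic_of_surjective e.symm e.symm.surjective

/-- Commuting elements of a free group are powers of a common element. -/
theorem IsFreeGroup.exists_zpow_of_commute {G : Type*} [Group G] [IsFreeGroup G] {s t : G}
    (h : Commute s t) : ∃ (r : G) (j k : ℤ), r ^ j = s ∧ r ^ k = t := by
  let K := Subgroup.closure {s, t}
  have hK : ∀ x y : K, Commute x y := by
    have : IsMulCommutative K := Subgroup.isMulCommutative_closure (by
      rintro x (rfl | rfl) y (rfl | rfl)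
      exacts [rfl, h.eq, h.eq.symm, rfl])
    exact fun x y => mul_comm' x y
  obtain ⟨r, hr⟩ := (IsFreeGroup.isCyclic_of_forall_commute hK).exists_generator
  obtain ⟨j, hj⟩ := hr ⟨s, Subgroup.subset_closure (by simp)⟩
  obtain ⟨k, hk⟩ := hr ⟨t, Subgroup.subset_closure (by simp)⟩
  exact ⟨r, j, k, by simpa using congrArg Subtype.val hj, by simpa using congrArg Subtype.val hk⟩

/-- In a free group, the kernel of a homomorphism to `ℤ` contains the centralizer of each of its
non-trivial elements. -/
theorem IsFreeGroup.map_eq_one_of_commute {G : Type*} [Group G] [IsFreeGroup G]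
    (f : G →* Multiplicative ℤ) {s t : G} (h : Commute s t) (ht : t ≠ 1) (hft : f t = 1) :
    f s = 1 := by
  obtain ⟨r, j, k, rfl, rfl⟩ := IsFreeGroup.exists_zpow_of_commute h
  have hk : k ≠ 0 := by
    rintro rfl
    exact ht (zpow_zero r)
  have hr : f r = 1 := by
    rw [map_zpow] at hft
    exact (IsMulTorsionFree.zpow_eq_one_iff_left hk).1 hft
  rw [map_zpow, hr, one_zpow]

namespace FreeGroup

theorem map_lift {ι α G : Type*} [Group G] (f : FreeGroup α →* G) (A : ι → FreeGroup α)
    (w : FreeGroup ι) : f (lift A w) = lift (fun i => f (A i)) w :=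
  DFunLike.congr_fun (by ext; simp : f.comp (lift A) = lift fun i => f (A i)) w

theorem exists_finite_support {α : Type*} (x : FreeGroup α) :
    ∃ T : Set α, T.Finite ∧ ∀ g : α → α, (∀ a ∈ T, g a = a) → map g x = x := by
  obtain ⟨L, rfl⟩ := Quot.exists_rep x
  refine ⟨{a | a ∈ L.map Prod.fst}, List.finite_toSet _, fun g hg => ?_⟩
  change map g (mk L) = mk L
  rw [map.mk]
  congr 1
  refine (List.map_congr_left fun p hp => ?_).trans (List.map_id L)
  exact Prod.ext (hg _ (List.mem_map_of_mem hp)) rfl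

/-- Finitely many elements of a free group lie in a retract of countable rank. -/
theorem exists_retraction_int {ι α : Type*} [Finite ι] [Nonempty α] (A : ι → FreeGroup α) :
    ∃ (f : α → ℤ) (g : ℤ → α), ∀ i, map g (map f (A i)) = A i := by
  choose T hT hTA using fun i => exists_finite_support (A i)
  obtain ⟨f, hf⟩ :=
    Set.countable_iff_exists_injOn.1 (Set.finite_iUnion hT).countable
  refine ⟨fun a => f a, fun m => Function.invFunOn f (⋃ i, T i) m.toNat, fun i => ?_⟩
  rw [map.comp]
  refine hTA i _ fun a ha => ?_
  exact hf.leftInvOn_invFunOn (Set.mem_iUnion_of_mem i ha)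

/-- The action of `ℤ` on the free group on `ℤ` by translation of the generators. -/
def translation : Multiplicative ℤ →* MulAut (FreeGroup ℤ) where
  toFun m := freeGroupCongr (Equiv.addLeft m.toAdd)
  map_one' := by
    refine MulEquiv.toMonoidHom_injective (FreeGroup.ext_hom _ _ fun i => ?_)
    simp
  map_mul' m m' := by
    refine MulEquiv.toMonoidHom_injective (FreeGroup.ext_hom _ _ fun i => ?_)
    simp [add_assoc]

/-- A non-abelian free group maps to the semidirect product of the free group on `ℤ` with `ℤ`, and
this map splits over the normal factor. -/
theorem exists_splitting {α : Type*} [Nontrivial α] :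
    ∃ (φ : FreeGroup ℤ →* FreeGroup α)
      (ψ : FreeGroup α →* FreeGroup ℤ ⋊[translation] Multiplicative ℤ),
      ∀ x, ψ (φ x) = SemidirectProduct.inl x := by
  classical
  obtain ⟨a, b, hab⟩ := exists_pair_ne α
  let φ : FreeGroup ℤ →* FreeGroup α := lift fun i => of a ^ i * of b * (of a ^ i)⁻¹
  let ψ : FreeGroup α →* FreeGroup ℤ ⋊[translation] Multiplicative ℤ :=
    lift fun c => if c = a then SemidirectProduct.inr (Multiplicative.ofAdd 1)
      else SemidirectProduct.inl (of 0)
  refine ⟨φ, ψ, fun x => ?_⟩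
  refine DFunLike.congr_fun (f := ψ.comp φ) (g := SemidirectProduct.inl)
    (FreeGroup.ext_hom _ _ fun i => ?_) x
  have ha : ψ (of a) ^ i = SemidirectProduct.inr (Multiplicative.ofAdd i) := by
    simp only [ψ, lift_apply_of, if_true, ← map_zpow, ← ofAdd_zsmul]
    simp
  have hb : ψ (of b) = SemidirectProduct.inl (of 0) := by simp [ψ, hab.symm]
  have ht : translation (Multiplicative.ofAdd i) (of 0) = of i := by simp [translation]
  simp only [φ, MonoidHom.comp_apply, lift_apply_of, _root_.map_mul, _root_.map_inv, map_zpow, ha,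
    hb]
  rw [← _root_.map_inv, ← SemidirectProduct.inl_aut, ht]

end FreeGroup

theorem IsCTestWord.int {n : ℕ} {w : FreeGroup (Fin n)} {S : Type*} [Nontrivial S]
    (h : IsCTestWord n w S) : IsCTestWord n w ℤ := by
  refine ⟨h.1, fun A B hAB hA => ?_⟩
  obtain ⟨φ, ψ, hψ⟩ := FreeGroup.exists_splitting (α := S)
  have hφ : Function.Injective φ := fun x y hxy =>
    SemidirectProduct.inl_injective (by rw [← hψ, ← hψ, hxy])
  have hne : φ (FreeGroup.lift A w) ≠ 1 := (map_ne_one_iff φ hφ).2 hA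
  obtain ⟨s, hs⟩ := h.2 (fun i => φ (A i)) (fun i => φ (B i))
    (by rw [← FreeGroup.map_lift, ← FreeGroup.map_lift, hAB])
    (by rwa [← FreeGroup.map_lift])
  have hcomm : Commute s (φ (FreeGroup.lift A w)) := by
    have hconj : MulAut.conj s (φ (FreeGroup.lift A w)) = φ (FreeGroup.lift B w) := by
      rw [FreeGroup.map_lift, FreeGroup.map_lift]
      refine (FreeGroup.map_lift (MulAut.conj s).toMonoidHom _ w).trans ?_
      simp [hs]
    rw [← hAB, MulAut.conj_apply] at hconj
    exact mul_inv_eq_iff_eq_mul.1 hconj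
  have hright : (ψ s).right = 1 :=
    IsFreeGroup.map_eq_one_of_commute (SemidirectProduct.rightHom.comp ψ) hcomm hne
      (by simp [hψ])
  have hleft : ψ s = SemidirectProduct.inl (ψ s).left := SemidirectProduct.ext rfl hright
  refine ⟨(ψ s).left, fun i => SemidirectProduct.inl_injective (φ := FreeGroup.translation) ?_⟩
  rw [map_mul, map_mul, map_inv, ← hleft, ← hψ, ← hψ, ← hs, map_mul, map_mul, map_inv]

theorem IsCTestWord.of_int {n : ℕ} {w : FreeGroup (Fin n)} {S : Type*} [Nonempty S]
    (h : IsCTestWord n w ℤ) : IsCTestWord n w S := by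
  refine ⟨h.1, fun A B hAB hA => ?_⟩
  obtain ⟨f, g, hfg⟩ := FreeGroup.exists_retraction_int (Sum.elim A B)
  have hfA : ∀ i, FreeGroup.map g (FreeGroup.map f (A i)) = A i := fun i => hfg (.inl i)
  have hfB : ∀ i, FreeGroup.map g (FreeGroup.map f (B i)) = B i := fun i => hfg (.inr i)
  obtain ⟨s, hs⟩ := h.2 (fun i => FreeGroup.map f (A i)) (fun i => FreeGroup.map f (B i))
    (by rw [← FreeGroup.map_lift, ← FreeGroup.map_lift, hAB])
    (fun h1 => hA (by
      simpa only [FreeGroup.map_lift, hfA, map_one] using congrArg (FreeGroup.map g) h1))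
  exact ⟨FreeGroup.map g s, fun i => by
    simpa only [map_mul, map_inv, hfA, hfB] using congrArg (FreeGroup.map g) (hs i)⟩

/-- Being a C-test word does not depend on the choice of non-abelian free group. -/
theorem isCTestWord_iff_of_nontrivial {n : ℕ} (hn : 2 ≤ n) (w : FreeGroup (Fin n))
    (hw : w ≠ 1) (S S' : Type) [Nontrivial S] [Nontrivial S'] :
    IsCTestWord n w S ↔ IsCTestWord n w S' :=
  ⟨fun h => h.int.of_int, fun h => h.int.of_int⟩
end

section
/- Let n ≥ 2 and let w ∈ F_n be a C-test word with respect to F_n. Then w is not contained in a proper retract of F_n: if r : F_n → F_n is a group endomorphism with r ∘ r = r and w lies in the image of r, then r is surjective. -/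
/-- A C-test word is not contained in a proper retract of `F_n`. -/
theorem cTestWord_not_mem_proper_retract {n : ℕ} (hn : 2 ≤ n) (w : FreeGroup (Fin n))
    (hw : IsCTestWord n w (Fin n)) (r : FreeGroup (Fin n) →* FreeGroup (Fin n))
    (hidem : r.comp r = r) (hmem : w ∈ r.range) :
    Function.Surjective r := by
  obtain ⟨v, rfl⟩ := hmem
  have hfix : r (r v) = r v := DFunLike.congr_fun hidem v
  have hlift : FreeGroup.lift (fun i => r (FreeGroup.of i)) = r := by
    ext i
    simp
  have hid : FreeGroup.lift (FreeGroup.of : Fin n → FreeGroup (Fin n)) = MonoidHom.id _ := by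
    ext i
    simp
  obtain ⟨s, hs⟩ := hw.2 (fun i => r (FreeGroup.of i)) FreeGroup.of
    (by rw [hlift, hid, hfix, MonoidHom.id_apply]) (by rw [hlift, hfix]; exact hw.1)
  have hconj : (MulAut.conj s).toMonoidHom.comp r = MonoidHom.id _ := by
    ext i
    simpa using hs i
  intro y
  refine ⟨s * y * s⁻¹, (MulAut.conj s).injective ?_⟩
  simpa using DFunLike.congr_fun hconj (s * y * s⁻¹)
end

section
/- Let n ≥ 2 and let w ∈ F_n be a C-test word with respect to F_n. Then w lies in the commutator subgroup [F_n, F_n] of F_n. -/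
namespace FreeGroup

/-- The sum of the exponents with which the generator `i` occurs in a word. -/
def exponentSum {α : Type*} [DecidableEq α] (i : α) : FreeGroup α →* Multiplicative ℤ :=
  lift (Pi.mulSingle i (Multiplicative.ofAdd 1))

theorem lift_eq_prod_zpow_exponentSum {α G : Type*} [DecidableEq α] [Fintype α] [CommGroup G]
    (f : α → G) (w : FreeGroup α) :
    lift f w = ∏ i, f i ^ (exponentSum i w).toAdd := by
  have h : lift f = ∏ i, (zpowersHom G (f i)).comp (exponentSum i) := by
    ext a
    rw [MonoidHom.finsetProd_apply, Finset.prod_eq_single a]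
    · simp [exponentSum]
    · intro b _ hb
      simp [exponentSum, Pi.mulSingle_eq_of_ne hb.symm]
    · simp
  rw [h, MonoidHom.finsetProd_apply]
  simp

theorem mem_commutator_of_exponentSum_eq_one {α : Type*} [DecidableEq α] [Fintype α]
    {w : FreeGroup α} (h : ∀ i, exponentSum i w = 1) : w ∈ commutator (FreeGroup α) := by
  have hw := lift_eq_prod_zpow_exponentSum (fun a ↦ Abelianization.of (of a)) w
  rw [show lift (fun a ↦ Abelianization.of (of a)) = Abelianization.of by ext; simp] at hw
  rw [← Abelianization.ker_of, MonoidHom.mem_ker, hw]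
  simp [h]

theorem lift_zpow_eq_zpow_sum {α G : Type*} [DecidableEq α] [Fintype α] [Group G]
    (x : G) (k : α → ℤ) (w : FreeGroup α) :
    lift (fun i ↦ x ^ k i) w = x ^ ∑ i, k i * (exponentSum i w).toAdd := by
  have h : lift (fun i ↦ x ^ k i) =
      (zpowersHom G x).comp (lift fun i ↦ Multiplicative.ofAdd (k i)) := by
    ext a
    simp
  rw [h, MonoidHom.comp_apply, lift_eq_prod_zpow_exponentSum, zpowersHom_apply, toAdd_prod]
  simp [mul_comm]

end FreeGroup

/-- Every C-test word lies in the commutator subgroup of `F_n`. -/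
theorem cTestWord_mem_commutator {n : ℕ} (hn : 2 ≤ n) (w : FreeGroup (Fin n))
    (hw : IsCTestWord n w (Fin n)) :
    w ∈ commutator (FreeGroup (Fin n)) := by
  by_contra hc
  obtain ⟨j, hj⟩ : ∃ j, FreeGroup.exponentSum j w ≠ 1 := by
    by_contra! h
    exact hc (FreeGroup.mem_commutator_of_exponentSum_eq_one h)
  have : Nontrivial (Fin n) := Fin.nontrivial_iff_two_le.mpr hn
  obtain ⟨i, hij⟩ := exists_ne j
  let e : Fin n → ℤ := fun l ↦ (FreeGroup.exponentSum l w).toAdd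
  have hej : e j ≠ 0 := fun h ↦ hj (toAdd_eq_zero.mp h)
  let x : FreeGroup (Fin n) := FreeGroup.of j
  have hx : x ^ e j ≠ 1 := by
    rw [Ne, IsMulTorsionFree.zpow_eq_one_iff_left hej]
    exact FreeGroup.of_ne_one j
  let k : Fin n → ℤ := Pi.single j 1
  let m : Fin n → ℤ := Pi.single i (e j) + Pi.single j (1 - e i)
  have hk : FreeGroup.lift (fun l ↦ x ^ k l) w = x ^ e j := by
    rw [FreeGroup.lift_zpow_eq_zpow_sum]
    simp [k, e, Pi.single_apply]
  have hm : FreeGroup.lift (fun l ↦ x ^ m l) w = x ^ e j := by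
    rw [FreeGroup.lift_zpow_eq_zpow_sum]
    congr 1
    simp only [m, Pi.add_apply, add_mul, Finset.sum_add_distrib, Pi.single_apply, ite_mul,
      zero_mul, Finset.sum_ite_eq', Finset.mem_univ, if_true]
    simp only [e]
    ring
  obtain ⟨s, hs⟩ := hw.2 _ _ (hk.trans hm.symm) (hk ▸ hx)
  have hi := hs i
  simp only [k, m, Pi.add_apply, Pi.single_eq_same, Pi.single_eq_of_ne hij, add_zero, zpow_zero,
    mul_one, mul_inv_cancel] at hi
  exact hx hi.symm
end

section
/- Let n ≥ 2 and let w ∈ F_n be a C-test word with respect to F_n which is not a proper power. Then the stabilizer of w in Aut(F_n) is the cyclic subgroup generated by conjugation by w: for every automorphism α of F_n, α(w) = w if and only if there exists k ∈ ℤ such that α(g) = w^k g w^{-k} for all g ∈ F_n. -/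
/-- An element of a group is a proper power if it is `v ^ k` for some `k ≥ 2`. -/
def IsProperPower {G : Type*} [Group G] (w : G) : Prop :=
  ∃ (v : G) (k : ℕ), 2 ≤ k ∧ w = v ^ k

/-- Distinct free generators do not commute. -/
theorem FreeGroup.eq_of_commute_of {X : Type*} {a b : X}
    (h : Commute (FreeGroup.of a) (FreeGroup.of b)) : a = b := by
  classical
  by_contra hab
  let f : X → Equiv.Perm (Fin 3) :=
    fun c => if c = a then Equiv.swap 0 1 else Equiv.swap 1 2
  have hf := h.map (FreeGroup.lift f)
  simp only [FreeGroup.lift_apply_of, f, if_true, if_neg (Ne.symm hab)] at hf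
  exact absurd hf.eq (by decide)

/-- A commutative free group is cyclic. -/
theorem IsFreeGroup.isCyclic_of_isMulCommutative (G : Type*) [Group G] [IsFreeGroup G]
    [IsMulCommutative G] : IsCyclic G := by
  let e := IsFreeGroup.toFreeGroup G
  have : Subsingleton (IsFreeGroup.Generators G) := ⟨fun a b =>
    FreeGroup.eq_of_commute_of <| e.symm.injective <| by
      simp only [map_mul]
      exact mul_comm' _ _⟩
  rcases isEmpty_or_nonempty (IsFreeGroup.Generators G) with _ | ⟨⟨a⟩⟩
  · have : Subsingleton G := e.toEquiv.subsingleton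
    infer_instance
  · have := uniqueOfSubsingleton a
    exact isCyclic_of_surjective e.symm e.symm.surjective

/-- Commuting elements of a free group are powers of a common element. -/
theorem FreeGroup.exists_zpow_eq_of_commute {X : Type*} {a b : FreeGroup X} (h : Commute a b) :
    ∃ (v : FreeGroup X) (k m : ℤ), v ^ k = a ∧ v ^ m = b := by
  have hcomm : IsMulCommutative (Subgroup.closure {a, b}) :=
    Subgroup.isMulCommutative_closure <| by
      rintro x (rfl | rfl) y (rfl | rfl)
      exacts [rfl, h.eq, h.eq.symm, rfl]
  obtain ⟨v, hv⟩ := IsFreeGroup.isCyclic_of_isMulCommutative (Subgroup.closure {a, b})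
  obtain ⟨k, hk⟩ := hv ⟨a, Subgroup.subset_closure (by simp)⟩
  obtain ⟨m, hm⟩ := hv ⟨b, Subgroup.subset_closure (by simp)⟩
  exact ⟨v, k, m, congrArg Subtype.val hk, congrArg Subtype.val hm⟩

/-- If a nontrivial power `v ^ k` is not a proper power, then `k` is a unit. -/
theorem isUnit_of_not_isProperPower_zpow {G : Type*} [Group G] {v : G} {k : ℤ}
    (h1 : v ^ k ≠ 1) (h : ¬ IsProperPower (v ^ k)) : k = 1 ∨ k = -1 := by
  by_contra! hk
  have hk0 : k ≠ 0 := by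
    rintro rfl
    exact h1 (zpow_zero v)
  rcases Int.natAbs_eq k with he | he
  · refine h ⟨v, k.natAbs, by omega, ?_⟩
    rw [← zpow_natCast, ← he]
  · refine h ⟨v⁻¹, k.natAbs, by omega, ?_⟩
    rw [← zpow_natCast, inv_zpow', ← he]

/-- An element of a free group commuting with a nontrivial `w` which is not a proper power is a
power of `w`. -/
theorem FreeGroup.exists_zpow_eq_of_commute_of_not_isProperPower {X : Type*} {w s : FreeGroup X}
    (h1 : w ≠ 1) (hw : ¬ IsProperPower w) (h : Commute w s) : ∃ k : ℤ, w ^ k = s := by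
  obtain ⟨v, k, m, rfl, rfl⟩ := FreeGroup.exists_zpow_eq_of_commute h
  rcases isUnit_of_not_isProperPower_zpow h1 hw with rfl | rfl
  · exact ⟨m, by simp⟩
  · exact ⟨-m, by simp⟩

/-- The stabilizer in `Aut (F_n)` of a C-test word which is not a proper power is the cyclic
subgroup generated by conjugation by `w`. -/
theorem stabilizer_cTestWord_eq_conj {n : ℕ} (hn : 2 ≤ n) (w : FreeGroup (Fin n))
    (hw : IsCTestWord n w (Fin n)) (hpow : ¬ IsProperPower w)
    (α : FreeGroup (Fin n) ≃* FreeGroup (Fin n)) :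
    α w = w ↔ ∃ k : ℤ, ∀ g : FreeGroup (Fin n), α g = w ^ k * g * w ^ (-k) := by
  constructor
  · intro hα
    have hid : FreeGroup.lift FreeGroup.of w = w := FreeGroup.lift_of_apply w
    have hlift : FreeGroup.lift (fun i => α (FreeGroup.of i)) = α.toMonoidHom := by
      ext i
      simp
    obtain ⟨s, hs⟩ := hw.2 FreeGroup.of (fun i => α (FreeGroup.of i))
      (by rw [hid, hlift]; exact hα.symm) (by rw [hid]; exact hw.1)
    have hconj : (MulAut.conj s).toMonoidHom = α.toMonoidHom := by
      ext i
      simpa using hs i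
    have hαs (g : FreeGroup (Fin n)) : α g = s * g * s⁻¹ := (DFunLike.congr_fun hconj g).symm
    have hcomm : Commute w s := (mul_inv_eq_iff_eq_mul.mp ((hαs w).symm.trans hα)).symm
    obtain ⟨k, rfl⟩ :=
      FreeGroup.exists_zpow_eq_of_commute_of_not_isProperPower hw.1 hpow hcomm
    exact ⟨k, fun g => by rw [hαs, zpow_neg]⟩
  · rintro ⟨k, hk⟩
    rw [hk, ← zpow_add_one, ← zpow_add]
    simp
end

section
/- For every n ≥ 2 there exists an element w_n ∈ F_n which is a C-test word with respect to every non-abelian free group and which is not a proper power. -/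
namespace FreeGroup

/-- The length of the longest common prefix of two lists. -/
def commonPrefixLength {β : Type*} [DecidableEq β] : List β → List β → ℕ
  | a :: l, b :: m => if a = b then commonPrefixLength l m + 1 else 0
  | _, _ => 0

theorem min_commonPrefixLength_le {β : Type*} [DecidableEq β] (l m k : List β) :
    min (commonPrefixLength l m) (commonPrefixLength m k) ≤ commonPrefixLength l k := by
  induction l generalizing m k with
  | nil => cases m <;> simp [commonPrefixLength]
  | cons a l ih =>
    cases m with
    | nil => simp [commonPrefixLength]
    | cons b m =>
      cases k with
      | nil => simp [commonPrefixLength]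
      | cons c k =>
        have := ih m k
        simp only [commonPrefixLength]
        split_ifs <;> simp_all

theorem commonPrefixLength_comm {β : Type*} [DecidableEq β] (l m : List β) :
    commonPrefixLength l m = commonPrefixLength m l := by
  induction l generalizing m with
  | nil => cases m <;> simp [commonPrefixLength]
  | cons a l ih =>
    cases m with
    | nil => simp [commonPrefixLength]
    | cons b m =>
      simp only [commonPrefixLength, ih m, eq_comm]

section Tree

variable {α : Type*} [DecidableEq α]

theorem norm_mk_inv_mul_mk {l m : List (α × Bool)} (hl : IsReduced l) (hm : IsReduced m) :
    norm ((mk l)⁻¹ * mk m) + 2 * commonPrefixLength l m = l.length + m.length := by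
  induction l generalizing m with
  | nil => simp [commonPrefixLength, ← one_eq_mk, norm, toWord_mk, hm.reduce_eq]
  | cons a l ih =>
    cases m with
    | nil =>
      simp only [commonPrefixLength, ← one_eq_mk, mul_one, norm_inv_eq]
      simp [norm, hl.reduce_eq]
    | cons b m =>
      by_cases hab : a = b
      · subst hab
        have h := ih (m := m) (List.IsChain.tail hl) (List.IsChain.tail hm)
        have e : (mk (a :: l))⁻¹ * mk (a :: m) = (mk l)⁻¹ * mk m := by
          have h1 : ∀ k : List (α × Bool), mk (a :: k) = mk [a] * mk k := fun k => by
            rw [mul_mk]; rfl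
          rw [h1 l, h1 m]; group
        rw [e]
        simp only [commonPrefixLength, if_true, List.length_cons]
        omega
      · have hr : IsReduced (invRev (a :: l) ++ b :: m) := by
          have hi : IsReduced (invRev (a :: l)) := by
            rw [isReduced_iff_reduce_eq] at hl ⊢
            rw [reduce_invRev, hl]
          unfold IsReduced at *
          rw [List.isChain_append]
          refine ⟨hi, hm, ?_⟩
          intro x hx y hy
          simp [invRev] at hx hy
          subst hx hy
          intro h
          rcases a with ⟨a1, a2⟩
          rcases b with ⟨b1, b2⟩
          simp at h hab ⊢
          subst h
          simp at hab
          cases a2 <;> cases b2 <;> simp_all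
        rw [inv_mk, mul_mk, norm, toWord_mk, hr.reduce_eq]
        simp [commonPrefixLength, hab]

/-- The word metric on a free group, with integer values. -/
def wdist (g h : FreeGroup α) : ℤ := norm (g⁻¹ * h)

theorem wdist_mul_left (k g h : FreeGroup α) : wdist (k * g) (k * h) = wdist g h := by
  simp only [wdist]; congr 2; group

theorem wdist_comm (g h : FreeGroup α) : wdist g h = wdist h g := by
  simp only [wdist]; rw [← norm_inv_eq]; congr 2; group

theorem wdist_nonneg (g h : FreeGroup α) : 0 ≤ wdist g h := by simp [wdist]

theorem wdist_self (g : FreeGroup α) : wdist g g = 0 := by simp [wdist]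

theorem eq_of_wdist_le {g h : FreeGroup α} (H : wdist g h ≤ 0) : g = h := by
  have : norm (g⁻¹ * h) = 0 := by simp only [wdist] at H; omega
  rwa [norm_eq_zero, inv_mul_eq_one] at this

theorem wdist_pos {g h : FreeGroup α} (H : g ≠ h) : 0 < wdist g h := by
  by_contra hn
  exact H (eq_of_wdist_le (by omega))

theorem wdist_triangle (g h k : FreeGroup α) : wdist g k ≤ wdist g h + wdist h k := by
  have := norm_mul_le (g⁻¹ * h) (h⁻¹ * k)
  simp only [wdist]
  rw [show g⁻¹ * h * (h⁻¹ * k) = g⁻¹ * k by group] at this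
  exact_mod_cast this

theorem wdist_add_commonPrefixLength (g h : FreeGroup α) :
    wdist g h + 2 * commonPrefixLength g.toWord h.toWord = norm g + norm h := by
  have := norm_mk_inv_mul_mk (isReduced_toWord (x := g)) (isReduced_toWord (x := h))
  rw [mk_toWord, mk_toWord] at this
  simp only [wdist, norm] at *
  exact_mod_cast this

/-- The four point condition: the word metric of a free group is the metric of a tree. -/
theorem wdist_four_point (a b c d : FreeGroup α) :
    wdist a b + wdist c d ≤ wdist a c + wdist b d ∨
      wdist a b + wdist c d ≤ wdist a d + wdist b c := by
  have h1 := min_commonPrefixLength_le b.toWord c.toWord d.toWord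
  have h2 := min_commonPrefixLength_le b.toWord d.toWord c.toWord
  have h3 := min_commonPrefixLength_le c.toWord a.toWord b.toWord
  have h4 := min_commonPrefixLength_le d.toWord a.toWord b.toWord
  have h5 := min_commonPrefixLength_le c.toWord b.toWord d.toWord
  have h6 := min_commonPrefixLength_le c.toWord a.toWord d.toWord
  have h7 := min_commonPrefixLength_le a.toWord c.toWord b.toWord
  have h8 := min_commonPrefixLength_le a.toWord d.toWord b.toWord
  have c1 := commonPrefixLength_comm a.toWord b.toWord
  have c2 := commonPrefixLength_comm a.toWord c.toWord
  have c3 := commonPrefixLength_comm a.toWord d.toWord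
  have c4 := commonPrefixLength_comm b.toWord c.toWord
  have c5 := commonPrefixLength_comm b.toWord d.toWord
  have c6 := commonPrefixLength_comm c.toWord d.toWord
  have e1 := wdist_add_commonPrefixLength a b
  have e2 := wdist_add_commonPrefixLength a c
  have e3 := wdist_add_commonPrefixLength a d
  have e4 := wdist_add_commonPrefixLength b c
  have e5 := wdist_add_commonPrefixLength b d
  have e6 := wdist_add_commonPrefixLength c d
  omega

end Tree

end FreeGroup

namespace FreeGroup
section Axis

variable {α : Type*} [DecidableEq α]

/-- `p` lies on the axis of `c` (acting by left multiplication on the Cayley tree). -/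
def IsAxisPoint (c p : FreeGroup α) : Prop := wdist p (c ^ 2 * p) = 2 * wdist p (c * p)

theorem wdist_mul_self_pos {c : FreeGroup α} (hc : c ≠ 1) (p : FreeGroup α) :
    0 < wdist p (c * p) := by
  apply wdist_pos
  intro h
  exact hc (by simpa using h.symm)

theorem wdist_mul_right_eq (g a b : FreeGroup α) : wdist (g * a) b = wdist a (g⁻¹ * b) := by
  rw [← wdist_mul_left g⁻¹ (g * a) b, inv_mul_cancel_left]

theorem wdist_inv_mul_self (g p : FreeGroup α) : wdist p (g⁻¹ * p) = wdist p (g * p) := by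
  rw [← wdist_mul_right_eq, wdist_comm]

theorem IsAxisPoint.wdist_pow {c p : FreeGroup α} (h : IsAxisPoint c p) (n : ℕ) :
    wdist p (c ^ n * p) = n * wdist p (c * p) := by
  by_cases hc : c = 1
  · subst hc; simp [wdist_self]
  have hpos := wdist_mul_self_pos hc p
  induction n using Nat.strong_induction_on with
  | _ n ih =>
    match n with
    | 0 => simp [wdist_self]
    | 1 => simp
    | n + 2 =>
      have h1 := ih n (by omega)
      have h2 := ih (n + 1) (by omega)
      have h3 := wdist_four_point p (c ^ (n + 1) * p) (c ^ n * p) (c ^ (n + 2) * p)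
      have e1 : wdist (c ^ n * p) (c ^ (n + 2) * p) = 2 * wdist p (c * p) := by
        rw [pow_add, mul_assoc, wdist_mul_left]; exact h
      have e2 : wdist (c ^ (n + 1) * p) (c ^ (n + 2) * p) = wdist p (c * p) := by
        rw [show c ^ (n + 2) = c ^ (n + 1) * c by rw [← pow_succ], mul_assoc, wdist_mul_left]
      have e3 : wdist (c ^ (n + 1) * p) (c ^ n * p) = wdist p (c * p) := by
        rw [wdist_comm, pow_succ, mul_assoc, wdist_mul_left]
      have e4 := wdist_triangle p (c ^ (n + 1) * p) (c ^ (n + 2) * p)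
      push_cast at *
      rw [e1, e2, e3] at h3
      rw [e2] at e4
      rcases h3 with h3 | h3 <;> linarith

theorem IsAxisPoint.wdist_zpow {c p : FreeGroup α} (h : IsAxisPoint c p) (i : ℤ) :
    wdist p (c ^ i * p) = |i| * wdist p (c * p) := by
  obtain ⟨n, rfl | rfl⟩ := i.eq_nat_or_neg
  · simpa using h.wdist_pow n
  · rw [zpow_neg, wdist_inv_mul_self]
    simpa using h.wdist_pow n

theorem IsAxisPoint.wdist_zpow_zpow {c p : FreeGroup α} (h : IsAxisPoint c p) (i j : ℤ) :
    wdist (c ^ i * p) (c ^ j * p) = |j - i| * wdist p (c * p) := by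
  rw [wdist_mul_right_eq, ← h.wdist_zpow, ← mul_assoc, ← zpow_neg, ← zpow_add]
  congr 3; ring

theorem IsAxisPoint.zpow {c p : FreeGroup α} (h : IsAxisPoint c p) (i : ℤ) :
    IsAxisPoint (c ^ i) p := by
  unfold IsAxisPoint
  rw [h.wdist_zpow, ← zpow_natCast, ← zpow_mul, h.wdist_zpow, abs_mul]
  simp; ring

theorem IsAxisPoint.inv {c p : FreeGroup α} (h : IsAxisPoint c p) : IsAxisPoint c⁻¹ p := by
  simpa using h.zpow (-1)

theorem IsAxisPoint.conj {c p : FreeGroup α} (h : IsAxisPoint c p) (g : FreeGroup α) :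
    IsAxisPoint (g * c * g⁻¹) (g * p) := by
  unfold IsAxisPoint at *
  rw [conj_pow]
  simpa [mul_assoc, wdist_mul_left] using h

theorem wdist_conj_mul (g c p : FreeGroup α) :
    wdist (g * p) (g * c * g⁻¹ * (g * p)) = wdist p (c * p) := by
  simp [mul_assoc, wdist_mul_left]

theorem IsAxisPoint.mul_of_commute {c p z : FreeGroup α} (h : IsAxisPoint c p)
    (hz : Commute z c) : IsAxisPoint c (z * p) := by
  have := h.conj z
  rwa [hz.eq, mul_inv_cancel_right] at this

theorem wdist_mul_of_commute {c z : FreeGroup α} (p : FreeGroup α)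
    (hz : Commute z c) : wdist (z * p) (c * (z * p)) = wdist p (c * p) := by
  rw [← mul_assoc, ← hz.eq, mul_assoc, wdist_mul_left]

/-- Every point `p` has a projection `q` to the axis of `g`. -/
theorem exists_isAxisPoint (g p : FreeGroup α) :
    ∃ q, IsAxisPoint g q ∧ ∀ n : ℕ, n ≠ 0 →
      wdist p (g ^ n * p) = 2 * wdist p q + n * wdist q (g * q) := by
  set w := p⁻¹ * g * p with hw
  set u := mk (reduceCyclically.conjugator w.toWord) with hu
  set r := reduceCyclically w.toWord with hr
  have hred : IsReduced w.toWord := isReduced_toWord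
  have hcyc : IsCyclicallyReduced r := reduceCyclically.isCyclicallyReduced hred
  have hw2 : w = u * mk r * u⁻¹ := by
    conv_lhs => rw [← mk_toWord (x := w),
      ← reduceCyclically.conj_conjugator_reduceCyclically w.toWord]
    rw [← mul_mk, ← mul_mk, ← inv_mk]
  have hg : g = p * w * p⁻¹ := by rw [hw]; group
  have hnr : ∀ n : ℕ, (norm (mk r ^ n) : ℤ) = n * r.length := by
    intro n
    have hm : (mk r).toWord = r := by rw [toWord_mk, hcyc.isReduced.reduce_eq]
    rw [norm, toWord_pow, hm, (hcyc.flatten_replicate n).isReduced.reduce_eq]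
    simp
  have hq : ∀ n : ℕ, wdist (p * u) (g ^ n * (p * u)) = n * r.length := by
    intro n
    rw [← hnr, wdist, hg, hw2]
    simp only [conj_pow]
    congr 2; group
  have hpu : wdist p (p * u) = (reduceCyclically.conjugator w.toWord).length := by
    rw [wdist, inv_mul_cancel_left, norm, hu, toWord_mk]
    have : IsReduced (reduceCyclically.conjugator w.toWord) := by
      rw [← reduceCyclically.conj_conjugator_reduceCyclically w.toWord, List.append_assoc] at hred
      exact List.IsChain.left_of_append hred
    rw [this.reduce_eq]
  have h1 : wdist (p * u) (g * (p * u)) = r.length := by simpa using hq 1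
  refine ⟨p * u, ?_, ?_⟩
  · unfold IsAxisPoint
    rw [hq 2, h1]; simp
  · intro n hn
    rw [hpu, h1]
    have : wdist p (g ^ n * p) = norm (w ^ n) := by
      rw [wdist, hg, conj_pow]; congr 2; group
    rw [this, norm, toWord_pow, reduceCyclically.reduce_flatten_replicate hred, if_neg hn]
    simp [invRev_length]
    ring

end Axis
end FreeGroup

namespace FreeGroup
section Overlap

variable {α : Type*} [DecidableEq α]

/-- `v` lies on the geodesic from `a` to `b`. -/
def IsBetween (a v b : FreeGroup α) : Prop := wdist a v + wdist v b = wdist a b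

theorem IsBetween.wdist_eq {a b u v : FreeGroup α} (hu : IsBetween a u b) (hv : IsBetween a v b)
    (h : wdist a u ≤ wdist a v) : wdist u v = wdist a v - wdist a u := by
  unfold IsBetween at *
  have h1 := wdist_four_point u v a b
  have h2 := wdist_triangle a u v
  have c1 := wdist_comm u a
  have c2 := wdist_comm v a
  rcases h1 with h1 | h1 <;> linarith

theorem IsAxisPoint.isBetween_translate {g q v : FreeGroup α} (h : IsAxisPoint g q) {n : ℕ}
    (hv : IsBetween q v (g ^ n * q))
    (hn : wdist q v + wdist q (g * q) ≤ wdist q (g ^ n * q)) :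
    IsBetween q (g * v) (g ^ n * q) ∧ wdist q (g * v) = wdist q v + wdist q (g * q) := by
  have e0 := h.wdist_pow n
  have e1 := h.wdist_pow (n + 1)
  have e2 : wdist (g * q) (g ^ (n + 1) * q) = wdist q (g ^ n * q) := by
    rw [pow_succ', mul_assoc, wdist_mul_left]
  have e3 : wdist (g * q) (g * v) = wdist q v := wdist_mul_left ..
  have e4 : wdist (g * v) (g ^ (n + 1) * q) = wdist v (g ^ n * q) := by
    rw [pow_succ', mul_assoc, wdist_mul_left]
  have e5 : wdist (g ^ n * q) (g ^ (n + 1) * q) = wdist q (g * q) := by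
    rw [pow_succ, mul_assoc, wdist_mul_left]
  have t1 := wdist_triangle q (g * q) (g * v)
  have t2 := wdist_triangle q (g * v) (g ^ (n + 1) * q)
  push_cast at e1
  have hb1 : IsBetween q (g ^ n * q) (g ^ (n + 1) * q) := by
    unfold IsBetween; linarith
  have hb2 : IsBetween q (g * v) (g ^ (n + 1) * q) := by
    unfold IsBetween at *; linarith
  have hpos : wdist q (g * v) = wdist q v + wdist q (g * q) := by
    unfold IsBetween at *; linarith
  have h3 := hb2.wdist_eq hb1 (by linarith)
  refine ⟨?_, hpos⟩
  unfold IsBetween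
  linarith

theorem isBetween_of_projection {p r q s x : FreeGroup α} (hx : IsBetween p x r)
    (h1 : wdist p q + wdist p r - wdist q r < 2 * wdist p x)
    (h2 : wdist r s + wdist p r - wdist p s ≤ 2 * wdist x r) :
    IsBetween q x r ∧ IsBetween q x s := by
  unfold IsBetween at *
  have a1 := wdist_four_point p r x q
  have a2 := wdist_four_point p r x s
  have a3 := wdist_four_point q r x s
  have a4 := wdist_four_point p s q x
  have t1 := wdist_triangle q x r
  have t2 := wdist_triangle p x s
  have t3 := wdist_triangle q x s
  have t4 := wdist_triangle p x q
  have t5 := wdist_triangle r x s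
  have c1 := wdist_comm p q
  have c2 := wdist_comm r q
  have c3 := wdist_comm x q
  have c4 := wdist_comm r x
  have c5 := wdist_comm s x
  have c6 := wdist_comm s r
  have c7 := wdist_comm s q
  have n1 := wdist_nonneg x q
  have n2 := wdist_nonneg x s
  omega

/-- Two elements whose axes overlap for long enough commute. -/
theorem commute_of_long_overlap {c d p q : FreeGroup α} (hc : c ≠ 1) (hp : IsAxisPoint c p)
    (hq : IsAxisPoint d q) (k l : ℕ)
    (h : wdist p q + wdist (c ^ k * p) (d ^ l * q) + 6 * (wdist p (c * p) + wdist q (d * q))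
      ≤ wdist p (c ^ k * p) + wdist q (d ^ l * q)) : Commute c d := by
  set r := c ^ k * p with hr
  set s := d ^ l * q with hs
  have hlc := wdist_mul_self_pos hc p
  set lc := wdist p (c * p) with hlc'
  set ld := wdist q (d * q) with hld'
  have hld : 0 ≤ ld := wdist_nonneg _ _
  have hpr : wdist p r = k * lc := hp.wdist_pow k
  have hfp := wdist_four_point p r q s
  -- the two ends of the overlap, along the axis of `c`
  have tA := wdist_triangle q p r
  have tB := wdist_triangle p r s
  have tC := wdist_triangle p q r
  have tD := wdist_triangle p s r
  have tE := wdist_triangle q p r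
  have cqp := wdist_comm q p
  have crs := wdist_comm r s
  have crq := wdist_comm r q
  obtain ⟨i, hi1, hi2⟩ : ∃ i : ℕ, wdist p q + wdist p r - wdist q r < 2 * (i * lc) ∧
      2 * (i * lc) ≤ wdist p q + wdist p r - wdist q r + 2 * lc := by
    set a := wdist p q + wdist p r - wdist q r with ha
    have ha0 : 0 ≤ a := by omega
    have hd := Int.ediv_mul_add_emod a (2 * lc)
    have hm1 := Int.emod_nonneg a (b := 2 * lc) (by omega)
    have hm2 := Int.emod_lt_of_pos a (b := 2 * lc) (by omega)
    have hdn : 0 ≤ a / (2 * lc) := Int.ediv_nonneg ha0 (by omega)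
    refine ⟨(a / (2 * lc) + 1).toNat, ?_, ?_⟩ <;>
    · rw [Int.toNat_of_nonneg (by omega)]
      nlinarith
  obtain ⟨j, hj1, hj2⟩ : ∃ j : ℕ, wdist r s + wdist p r - wdist p s ≤ 2 * (j * lc) ∧
      2 * (j * lc) ≤ wdist r s + wdist p r - wdist p s + 2 * lc := by
    set a := wdist r s + wdist p r - wdist p s with ha
    have ha0 : 0 ≤ a := by omega
    have hd := Int.ediv_mul_add_emod a (2 * lc)
    have hm1 := Int.emod_nonneg a (b := 2 * lc) (by omega)
    have hm2 := Int.emod_lt_of_pos a (b := 2 * lc) (by omega)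
    have hdn : 0 ≤ a / (2 * lc) := Int.ediv_nonneg ha0 (by omega)
    refine ⟨(a / (2 * lc) + 1).toNat, ?_, ?_⟩ <;>
    · rw [Int.toNat_of_nonneg (by omega)]
      nlinarith
  have hsum : (i : ℤ) * lc + j * lc + lc + ld ≤ k * lc := by
    omega
  have hijk : i + j ≤ k := by
    have : ((i + j : ℕ) : ℤ) * lc ≤ k * lc := by push_cast; linarith
    exact_mod_cast le_of_mul_le_mul_right this hlc
  obtain ⟨n, rfl⟩ := Nat.exists_eq_add_of_le hijk
  have hnl : lc + ld ≤ n * lc := by push_cast at hsum; linarith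
  set m := c ^ i * p with hm
  set m' := c ^ (i + n) * p with hm'
  have hmm' : m' = c ^ n * m := by rw [hm', hm, add_comm, pow_add, mul_assoc]
  have hpm : wdist p m = i * lc := hp.wdist_pow i
  have hpm' : wdist p m' = (i + n) * lc := by simpa using hp.wdist_pow (i + n)
  have hmr : wdist m r = (n + j) * lc := by
    rw [hr, hm, show i + j + n = i + (n + j) by ring, pow_add, mul_assoc, wdist_mul_left,
      hp.wdist_pow]
    push_cast; ring
  have hm'r : wdist m' r = j * lc := by
    rw [hr, hm', show i + j + n = i + n + j by ring, pow_add _ (i + n), mul_assoc, wdist_mul_left,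
      hp.wdist_pow]
  have hprm : IsBetween p m r := by unfold IsBetween; rw [hpm, hmr, hpr]; push_cast; ring
  have hprm' : IsBetween p m' r := by unfold IsBetween; rw [hpm', hm'r, hpr]; push_cast; ring
  have hnlc : 0 ≤ (n : ℤ) * lc := by positivity
  obtain ⟨hqmr, hqms⟩ := isBetween_of_projection (q := q) (s := s) hprm
    (by rw [hpm]; exact hi1) (by rw [hmr]; linarith)
  obtain ⟨hqm'r, hqm's⟩ := isBetween_of_projection (q := q) (s := s) hprm'
    (by rw [hpm']; linarith) (by rw [hm'r]; exact hj1)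
  have hqmm' : wdist q m' = wdist q m + n * lc := by
    unfold IsBetween at hqmr hqm'r; linarith
  have hmax : IsAxisPoint c m :=
    hp.mul_of_commute ((Commute.refl c).pow_left i)
  have hmlc : wdist m (c * m) = lc :=
    wdist_mul_of_commute p ((Commute.refl c).pow_left i)
  have hmn : wdist m m' = n * lc := by
    rw [hmm', hmax.wdist_pow, hmlc]
  -- translate by `d`, then by `c`
  have hs0 := wdist_nonneg m' s
  obtain ⟨hd1, hd2⟩ := hq.isBetween_translate (n := l) hqms (by
    rw [← hs, ← hld']; unfold IsBetween at hqm's; linarith)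
  rw [← hs] at hd1
  rw [← hld'] at hd2
  have hmd : wdist m (d * m) = ld := by
    have := hqms.wdist_eq hd1 (by linarith); linarith
  have hdm' : wdist (d * m) m' = n * lc - ld := by
    have := hd1.wdist_eq hqm's (by linarith); linarith
  obtain ⟨hcd1, hcd2⟩ := hmax.isBetween_translate (n := n) (v := d * m)
    (by rw [← hmm']; unfold IsBetween; linarith) (by rw [← hmm', hmlc]; linarith)
  rw [← hmm'] at hcd1
  -- translate by `c`, then by `d`
  obtain ⟨hc1, hc2⟩ := hmax.isBetween_translate (n := n) (v := m)
    (by unfold IsBetween; rw [wdist_self]; ring)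
    (by rw [← hmm', hmlc, wdist_self]; linarith)
  rw [← hmm'] at hc1
  have hqcm : IsBetween q (c * m) s ∧ wdist q (c * m) = wdist q m + lc := by
    have t1 := wdist_triangle q m (c * m)
    have t2 := wdist_triangle (c * m) m' s
    have t3 := wdist_triangle q (c * m) s
    rw [wdist_self] at hc2
    unfold IsBetween at *
    constructor <;> linarith
  obtain ⟨hdc1, hdc2⟩ := hq.isBetween_translate (n := l) hqcm.1 (by
    rw [← hs, ← hld']; unfold IsBetween at hqm's; linarith)
  rw [← hs] at hdc1
  rw [← hld'] at hdc2
  have hmdc : wdist m (d * (c * m)) = lc + ld := by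
    have := hqms.wdist_eq hdc1 (by linarith); linarith
  have hdcm' : wdist (d * (c * m)) m' = n * lc - lc - ld := by
    have := hdc1.wdist_eq hqm's (by linarith); linarith
  have hdcb : IsBetween m (d * (c * m)) m' := by unfold IsBetween; linarith
  have hfin := hcd1.wdist_eq hdcb (by linarith)
  have := eq_of_wdist_le (g := c * (d * m)) (h := d * (c * m)) (by linarith)
  rw [← mul_assoc c d m, ← mul_assoc d c m] at this
  exact mul_right_cancel (b := m) this

end Overlap
end FreeGroup

namespace FreeGroup

theorem isCyclic_of_commute {ι : Type*} (h : ∀ x y : FreeGroup ι, Commute x y) :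
    IsCyclic (FreeGroup ι) := by
  classical
  have hs : Subsingleton ι := by
    refine ⟨fun i j => ?_⟩
    by_contra hij
    have h1 := congrArg toWord (h (of i) (of j)).eq
    simp [of, toWord_mk, hij, Ne.symm hij, reduce] at h1
  rcases isEmpty_or_nonempty ι with hι | ⟨⟨i⟩⟩
  · infer_instance
  · have : Unique ι := uniqueOfSubsingleton i
    infer_instance

section Centralizer

variable {α : Type*}

theorem exists_common_root {a b : FreeGroup α} (h : Commute a b) :
    ∃ (e : FreeGroup α) (i j : ℤ), a = e ^ i ∧ b = e ^ j := by
  let H := Subgroup.closure ({a, b} : Set (FreeGroup α))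
  have hH : ∀ x y : H, Commute x y := by
    intro x y
    have hab : ∀ x ∈ ({a, b} : Set (FreeGroup α)), ∀ y ∈ ({a, b} : Set (FreeGroup α)),
        x * y = y * x := by
      rintro x (rfl | rfl) y (rfl | rfl)
      · rfl
      · exact h
      · exact h.symm
      · rfl
    have := Subgroup.isMulCommutative_closure hab
    exact this.is_comm.comm x y
  have hc : IsCyclic (FreeGroup (IsFreeGroup.Generators H)) := by
    apply isCyclic_of_commute
    intro x y
    have := (hH ((IsFreeGroup.toFreeGroup H).symm x) ((IsFreeGroup.toFreeGroup H).symm y)).map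
      (IsFreeGroup.toFreeGroup H)
    simpa using this
  have hcH : IsCyclic H :=
    isCyclic_of_surjective (IsFreeGroup.toFreeGroup H).symm (IsFreeGroup.toFreeGroup H).symm.surjective
  obtain ⟨e, he⟩ := hcH.exists_generator
  obtain ⟨i, hi⟩ := Subgroup.mem_zpowers_iff.1
    (he ⟨a, Subgroup.subset_closure (by simp)⟩)
  obtain ⟨j, hj⟩ := Subgroup.mem_zpowers_iff.1
    (he ⟨b, Subgroup.subset_closure (by simp)⟩)
  exact ⟨e, i, j, by simpa using (congrArg Subtype.val hi).symm,
    by simpa using (congrArg Subtype.val hj).symm⟩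

theorem zpow_left_inj_of_ne {a b : FreeGroup α} {n : ℤ} (hn : n ≠ 0) (h : a ^ n = b ^ n) :
    a = b := by
  obtain ⟨m, rfl | rfl⟩ := n.eq_nat_or_neg
  · exact pow_left_injective (n := m) (by simpa using hn) (by simpa using h)
  · exact pow_left_injective (n := m) (by simpa using hn) (by simpa using h)

theorem eq_one_of_zpow_eq_one {a : FreeGroup α} {n : ℤ} (hn : n ≠ 0) (h : a ^ n = 1) :
    a = 1 :=
  zpow_left_inj_of_ne hn (by rw [h, one_zpow])

theorem commute_of_commute_zpow {a b : FreeGroup α} {n : ℤ} (hn : n ≠ 0)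
    (h : Commute a (b ^ n)) : Commute a b := by
  have h1 : (a * b * a⁻¹) ^ n = b ^ n := by
    rw [conj_zpow, h.eq, mul_inv_cancel_right]
  have := zpow_left_inj_of_ne hn h1
  exact mul_inv_eq_iff_eq_mul.1 this

theorem commute_of_commute_zpow_zpow {a b : FreeGroup α} {m n : ℤ} (hm : m ≠ 0) (hn : n ≠ 0)
    (h : Commute (a ^ m) (b ^ n)) : Commute a b :=
  (commute_of_commute_zpow hm (commute_of_commute_zpow hn h).symm).symm

/-- Commuting elements satisfy a nontrivial power relation. -/
theorem exists_zpow_eq_zpow {a b : FreeGroup α} (ha : a ≠ 1) (h : Commute a b) :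
    ∃ i j : ℤ, j ≠ 0 ∧ a ^ i = b ^ j := by
  obtain ⟨e, i, j, rfl, rfl⟩ := exists_common_root h
  refine ⟨j, i, ?_, ?_⟩
  · rintro rfl; simp at ha
  · rw [← zpow_mul, ← zpow_mul, mul_comm]

theorem commute_trans {a b g : FreeGroup α} (hg : g ≠ 1) (ha : Commute a g) (hb : Commute b g) :
    Commute a b := by
  obtain ⟨i, j, hj, hij⟩ := exists_zpow_eq_zpow hg ha.symm
  refine (commute_of_commute_zpow (a := b) hj ?_).symm
  rw [← hij]
  exact hb.zpow_right i

theorem le_of_forall_mul_le {a b C : ℤ} (h : ∀ n : ℕ, n * a ≤ n * b + C) : a ≤ b := by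
  by_contra hlt
  have h1 := h (C.natAbs + 1)
  push_cast at h1
  have := le_abs_self C
  have h2 : 0 ≤ |C| := abs_nonneg C
  nlinarith

theorem commute_of_commute_conj {g x : FreeGroup α} (hg : g ≠ 1)
    (h : Commute (x * g * x⁻¹) g) : Commute x g := by
  classical
  have hxg : x * g * x⁻¹ ≠ 1 := by simpa using hg
  obtain ⟨i, j, hj, hij⟩ := exists_zpow_eq_zpow hxg h
  obtain ⟨p, hp, -⟩ := exists_isAxisPoint g 1
  have hl := wdist_mul_self_pos hg p
  have key : ∀ n : ℕ, x * g ^ (i * n) * x⁻¹ = g ^ (j * n) := by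
    intro n
    rw [zpow_mul g j, ← hij, ← zpow_mul, conj_zpow]
  have e1 : ∀ k : ℤ, wdist (x * p) (x * g ^ k * p) = |k| * wdist p (g * p) := by
    intro k; rw [mul_assoc, wdist_mul_left, hp.wdist_zpow]
  have e2 : ∀ k : ℤ, wdist (x * g ^ k * p) (x * g ^ k * x⁻¹ * p) = wdist p (x * p) := by
    intro k; rw [mul_assoc _ x⁻¹, wdist_mul_left, wdist_inv_mul_self]
  have h1 : |j| * wdist p (g * p) ≤ |i| * wdist p (g * p) := by
    refine le_of_forall_mul_le (C := 2 * wdist p (x * p)) fun n => ?_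
    have t1 := wdist_triangle p (x * p) (x * g ^ (i * n) * x⁻¹ * p)
    have t2 := wdist_triangle (x * p) (x * g ^ (i * n) * p) (x * g ^ (i * n) * x⁻¹ * p)
    rw [e1, e2, abs_mul, Nat.abs_cast] at t2
    rw [key, hp.wdist_zpow, abs_mul, Nat.abs_cast] at t1
    rw [key] at t2
    linarith
  have h2 : |i| * wdist p (g * p) ≤ |j| * wdist p (g * p) := by
    refine le_of_forall_mul_le (C := 2 * wdist p (x * p)) fun n => ?_
    have t1 := wdist_triangle (x * p) p (x * g ^ (i * n) * p)
    have t2 := wdist_triangle p (x * g ^ (i * n) * x⁻¹ * p) (x * g ^ (i * n) * p)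
    rw [wdist_comm (x * g ^ (i * n) * x⁻¹ * p), e2, key, hp.wdist_zpow, abs_mul, Nat.abs_cast] at t2
    rw [e1, abs_mul, Nat.abs_cast, wdist_comm _ p] at t1
    linarith
  have habs : |i| = |j| :=
    le_antisymm (le_of_mul_le_mul_right h2 hl) (le_of_mul_le_mul_right h1 hl)
  have hi : i ≠ 0 := by
    rintro rfl
    rw [abs_zero] at habs
    exact hj (abs_eq_zero.1 habs.symm)
  rw [conj_zpow] at hij
  rcases abs_eq_abs.1 habs with rfl | rfl
  · exact commute_of_commute_zpow hi (mul_inv_eq_iff_eq_mul.1 hij)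
  · refine commute_of_commute_zpow_zpow two_ne_zero hj ?_
    have hinv : x * g ^ j * x⁻¹ = g ^ (-j) := by
      have := congrArg (·⁻¹) hij
      simp only [zpow_neg] at this ⊢
      rw [← this]; group
    refine mul_inv_eq_iff_eq_mul.1 ?_
    calc x ^ (2 : ℤ) * g ^ j * (x ^ (2 : ℤ))⁻¹ = x * (x * g ^ j * x⁻¹) * x⁻¹ := by
          rw [zpow_two]; group
      _ = g ^ j := by rw [hinv, hij]

/-- Commuting elements have the same axis. -/
theorem IsAxisPoint.of_commute [DecidableEq α] {c d p : FreeGroup α} (hc : c ≠ 1)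
    (hcd : Commute c d) (h : IsAxisPoint c p) : IsAxisPoint d p := by
  obtain ⟨i, j, hj, hij⟩ := exists_zpow_eq_zpow hc hcd
  have h1 : IsAxisPoint (d ^ j) p := hij ▸ h.zpow i
  have h2 : IsAxisPoint (d ^ j.natAbs) p := by
    rcases j.natAbs_eq with hn | hn
    · rw [hn, zpow_natCast] at h1; exact h1
    · rw [hn, zpow_neg, zpow_natCast] at h1; simpa using h1.inv
  obtain ⟨q, hq, hn⟩ := exists_isAxisPoint d p
  have hja : j.natAbs ≠ 0 := by simpa using hj
  have e1 := hn j.natAbs hja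
  have e2 := hn (j.natAbs * 2) (by omega)
  unfold IsAxisPoint at h2
  rw [← pow_mul] at h2
  push_cast at e1 e2
  have hpq : p = q := eq_of_wdist_le (by linarith)
  rwa [hpq]

end Centralizer
end FreeGroup

namespace FreeGroup
section Deviation

variable {α : Type*} [DecidableEq α]

/-- Twice the Gromov product of `f` and `g` with respect to the base point `p`. -/
def gromov (p f g : FreeGroup α) : ℤ := wdist p f + wdist p g - wdist f g

theorem gromov_comm (p f g : FreeGroup α) : gromov p f g = gromov p g f := by
  unfold gromov; rw [wdist_comm f g]; ring

theorem gromov_mul_left (k p f g : FreeGroup α) :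
    gromov (k * p) (k * f) (k * g) = gromov p f g := by
  simp only [gromov, wdist_mul_left]

theorem gromov_ultrametric (p f g h : FreeGroup α) :
    gromov p f g ≤ gromov p f h ∨ gromov p g h ≤ gromov p f h := by
  have := wdist_four_point p g f h
  unfold gromov
  rw [wdist_comm g f] at this
  rcases this with h | h
  · right; linarith
  · left; linarith

theorem gromov_le_left (p f g : FreeGroup α) : gromov p f g ≤ 2 * wdist p f := by
  have := wdist_triangle p f g
  unfold gromov; linarith

/-- The effect of exchanging the two end points of a geodesic on Gromov products. -/
theorem gromov_mul_add (p g e : FreeGroup α) :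
    gromov p (g * p) (g * e) + gromov p (g⁻¹ * p) e = 2 * wdist p (g * p) := by
  unfold gromov
  have h1 : wdist (g⁻¹ * p) e = wdist p (g * e) := by rw [wdist_mul_right_eq, inv_inv]
  rw [wdist_mul_left, wdist_inv_mul_self, h1]
  ring

theorem IsAxisPoint.wdist_mul_self_le {c p f : FreeGroup α} (hp : IsAxisPoint c p)
    (hf : IsAxisPoint c f) : wdist f (c * f) ≤ wdist p (c * p) := by
  refine le_of_forall_mul_le (C := 2 * wdist p f) fun n => ?_
  rw [← hp.wdist_pow, ← hf.wdist_pow]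
  have t1 := wdist_triangle f p (c ^ n * f)
  have t2 := wdist_triangle p (c ^ n * p) (c ^ n * f)
  rw [wdist_mul_left] at t2
  rw [wdist_comm f p] at t1
  linarith

theorem IsAxisPoint.wdist_mul_self_eq {c p f : FreeGroup α} (hp : IsAxisPoint c p)
    (hf : IsAxisPoint c f) : wdist f (c * f) = wdist p (c * p) :=
  le_antisymm (hp.wdist_mul_self_le hf) (hf.wdist_mul_self_le hp)

theorem IsAxisPoint.exists_isBetween {c p f : FreeGroup α} (hc : c ≠ 1) (hp : IsAxisPoint c p)
    (hf : IsAxisPoint c f) : ∃ k : ℤ, IsBetween p f (c ^ k * p) := by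
  have hl := wdist_mul_self_pos hc p
  have hlf := hp.wdist_mul_self_eq hf
  set k : ℤ := 2 * wdist p f + 1 with hk
  have hk0 : 0 < k := by have := wdist_nonneg p f; omega
  have fp := wdist_four_point f (c ^ k * p) (c ^ (2 * k) * f) (c ^ (-k) * p)
  have e1 : wdist (c ^ (2 * k) * f) (c ^ (-k) * p) = wdist f (c ^ (-3 * k) * p) := by
    rw [wdist_mul_right_eq, ← mul_assoc, ← zpow_neg, ← zpow_add]; congr 3; ring
  have e2 : wdist (c ^ k * p) (c ^ (2 * k) * f) = wdist f (c ^ (-k) * p) := by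
    rw [wdist_comm, wdist_mul_right_eq, ← mul_assoc, ← zpow_neg, ← zpow_add]; congr 3; ring
  have e3 : wdist f (c ^ (2 * k) * f) = 2 * (k * wdist p (c * p)) := by
    rw [hf.wdist_zpow, hlf, abs_mul, abs_of_pos hk0]; simp; ring
  have e4 : wdist (c ^ k * p) (c ^ (-k) * p) = 2 * (k * wdist p (c * p)) := by
    rw [hp.wdist_zpow_zpow, show -k - k = -(2 * k) by ring, abs_neg, abs_mul, abs_of_pos hk0]
    simp; ring
  have e5 : wdist p (c ^ k * p) = k * wdist p (c * p) := by
    rw [hp.wdist_zpow, abs_of_pos hk0]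
  have e6 : wdist p (c ^ (-k) * p) = k * wdist p (c * p) := by
    rw [hp.wdist_zpow, abs_neg, abs_of_pos hk0]
  have e7 : wdist p (c ^ (-3 * k) * p) = 3 * (k * wdist p (c * p)) := by
    rw [hp.wdist_zpow, abs_mul, abs_of_pos hk0]; simp; ring
  have e8 : wdist (c ^ (-3 * k) * p) (c ^ k * p) = 4 * (k * wdist p (c * p)) := by
    rw [hp.wdist_zpow_zpow, show k - -3 * k = 4 * k by ring, abs_mul, abs_of_pos hk0]
    simp; ring
  have hkl : k ≤ k * wdist p (c * p) := by nlinarith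
  have t1 := wdist_triangle p f (c ^ k * p)
  have t2 := wdist_triangle p f (c ^ (-3 * k) * p)
  have t3 := wdist_triangle f p (c ^ (-k) * p)
  have t4 := wdist_triangle (c ^ (-3 * k) * p) f (c ^ k * p)
  have c1 := wdist_comm f p
  have c2 := wdist_comm f (c ^ (-3 * k) * p)
  have c3 := wdist_comm p (c ^ (-3 * k) * p)
  have hpb : IsBetween (c ^ (-3 * k) * p) p (c ^ k * p) := by unfold IsBetween; linarith
  have hfb : IsBetween (c ^ (-3 * k) * p) f (c ^ k * p) := by
    unfold IsBetween
    rcases fp with fp | fp <;> linarith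
  rcases le_total (wdist (c ^ (-3 * k) * p) p) (wdist (c ^ (-3 * k) * p) f) with h | h
  · refine ⟨k, ?_⟩
    have := hpb.wdist_eq hfb h
    unfold IsBetween at *
    linarith
  · refine ⟨-3 * k, ?_⟩
    have := hfb.wdist_eq hpb h
    unfold IsBetween at *
    linarith

theorem IsAxisPoint.wdist_conj_lt {c p a : FreeGroup α} (hc : c ≠ 1) (hp : IsAxisPoint c p)
    (ha : ¬ Commute a c) (i j : ℤ) :
    wdist p (c ^ i * p) + wdist p (c ^ j * p) <
      wdist (c ^ i * p) (a * (c ^ j * p)) + wdist p (a * p) + 12 * wdist p (c * p) := by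
  by_contra hcon
  push Not at hcon
  apply ha
  have hred : ∀ i : ℤ, ∃ (c' : FreeGroup α) (n : ℕ), (c' = c ∨ c' = c⁻¹) ∧ c' ^ n = c ^ i := by
    intro i
    obtain ⟨n, rfl | rfl⟩ := i.eq_nat_or_neg
    · exact ⟨c, n, Or.inl rfl, by simp⟩
    · exact ⟨c⁻¹, n, Or.inr rfl, by simp⟩
  obtain ⟨c1, n, h1, e1⟩ := hred i
  obtain ⟨c2, m, h2, e2⟩ := hred j
  have hax : ∀ c', c' = c ∨ c' = c⁻¹ → IsAxisPoint c' p ∧ c' ≠ 1 ∧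
      wdist p (c' * p) = wdist p (c * p) := by
    rintro c' (rfl | rfl)
    · exact ⟨hp, hc, rfl⟩
    · exact ⟨hp.inv, by simpa using hc, wdist_inv_mul_self _ _⟩
  obtain ⟨hp1, hc1, hl1⟩ := hax c1 h1
  obtain ⟨hp2, hc2, hl2⟩ := hax c2 h2
  have hcom := commute_of_long_overlap hc1 hp1 (hp2.conj a) n m (by
    rw [conj_pow, wdist_conj_mul, wdist_conj_mul, e1, e2, hl1, hl2]
    simp only [mul_assoc, inv_mul_cancel_left] at hcon ⊢
    linarith)
  have hcom' : Commute c (a * c * a⁻¹) := by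
    have hinv : a * c⁻¹ * a⁻¹ = (a * c * a⁻¹)⁻¹ := by group
    rcases h1 with h1 | h1 <;> rcases h2 with h2 | h2 <;> rw [h1, h2] at hcom
    · exact hcom
    · rwa [hinv, Commute.inv_right_iff] at hcom
    · rwa [Commute.inv_left_iff] at hcom
    · rwa [hinv, Commute.inv_right_iff, Commute.inv_left_iff] at hcom
  exact commute_of_commute_conj hc hcom'.symm

theorem IsAxisPoint.wdist_conj_lt_of_isAxisPoint {c p a f f' : FreeGroup α} (hc : c ≠ 1)
    (hp : IsAxisPoint c p) (ha : ¬ Commute a c) (hf : IsAxisPoint c f) (hf' : IsAxisPoint c f') :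
    wdist p f + wdist p f' <
      wdist f (a * f') + wdist p (a * p) + 12 * wdist p (c * p) := by
  obtain ⟨i, hi⟩ := hp.exists_isBetween hc hf
  obtain ⟨j, hj⟩ := hp.exists_isBetween hc hf'
  have h := hp.wdist_conj_lt hc ha i j
  unfold IsBetween at hi hj
  have t1 := wdist_triangle (c ^ i * p) f (a * (c ^ j * p))
  have t2 := wdist_triangle f (a * f') (a * (c ^ j * p))
  rw [wdist_mul_left] at t2
  rw [wdist_comm _ f] at t1
  linarith

/-- `e` lies far in the direction of the axis of `c`, as seen from the axis point `p`. -/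
def FollowsAxis (c p : FreeGroup α) (r : ℤ) (e : FreeGroup α) : Prop :=
  ∃ f, IsAxisPoint c f ∧ r ≤ gromov p f e

theorem FollowsAxis.gromov_mul_le {c p a e f : FreeGroup α} {B : ℤ} (hc : c ≠ 1)
    (hp : IsAxisPoint c p) (ha : ¬ Commute a c) (hB : wdist p (a * p) ≤ B)
    (he : FollowsAxis c p (12 * wdist p (c * p) + 4 * B) e) (hf : IsAxisPoint c f) :
    gromov p f (a * e) ≤ 12 * wdist p (c * p) + 2 * B := by
  obtain ⟨f', hf', hr⟩ := he
  have h1 := hp.wdist_conj_lt_of_isAxisPoint hc ha hf hf'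
  have t1 := wdist_triangle p (a * p) (a * f')
  have t2 := wdist_triangle (a * p) p (a * f')
  have t3 := wdist_triangle (a * p) p (a * e)
  have c1 := wdist_comm p (a * p)
  simp only [wdist_mul_left] at t1 t2 t3
  have hu := gromov_ultrametric p f (a * e) (a * f')
  unfold gromov at *
  rw [wdist_mul_left] at hu
  rw [wdist_comm e f'] at hu
  omega

theorem IsAxisPoint.le_gromov_zpow_mul {c p e : FreeGroup α} {E : ℤ} (hp : IsAxisPoint c p)
    (h : ∀ f, IsAxisPoint c f → gromov p f e ≤ E) (i : ℤ) :
    2 * (|i| * wdist p (c * p)) - E ≤ gromov p (c ^ i * p) (c ^ i * e) := by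
  have h1 := gromov_mul_add p (c ^ i) e
  have h2 := h ((c ^ i)⁻¹ * p) (hp.mul_of_commute ((Commute.refl c).zpow_left i).inv_left)
  rw [hp.wdist_zpow] at h1
  linarith

end Deviation
end FreeGroup

namespace FreeGroup
section Short

open scoped commutatorElement

variable {α : Type*} [DecidableEq α]

theorem gromov_pow_pow_lt {x y p q : FreeGroup α} (hy : y ≠ 1) (hxy : ¬ Commute x y)
    (hp : IsAxisPoint y p) (hq : IsAxisPoint x q)
    (hpq : ∀ n : ℕ, n ≠ 0 → wdist p (x ^ n * p) = 2 * wdist p q + n * wdist q (x * q))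
    (hle : wdist q (x * q) ≤ wdist p (y * p))
    (hmin : wdist p (x * p) ≤ wdist (y * p) (x * (y * p))) {m : ℕ} (hm : m ≠ 0) :
    gromov p (x ^ m * p) (y ^ m * p) < 16 * wdist p (y * p) := by
  by_contra hcon
  push Not at hcon
  have hb := wdist_mul_self_pos hy p
  have hxm := hpq m hm
  have hx1 := hpq 1 one_ne_zero
  have hym := hp.wdist_pow m
  have hxqm := hq.wdist_pow m
  simp only [pow_one, Nat.cast_one, one_mul] at hx1
  have c1 := wdist_comm q p
  rcases lt_or_ge (wdist p q) (wdist p (y * p)) with h | h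
  · apply hxy
    refine (commute_of_long_overlap hy hp hq m m ?_).symm
    have t1 := wdist_triangle (y ^ m * p) (x ^ m * p) (x ^ m * q)
    rw [wdist_mul_left] at t1
    have c2 := wdist_comm (x ^ m * p) (y ^ m * p)
    unfold gromov at hcon
    linarith
  · have hqb : IsBetween p q (x ^ m * p) := by
      have t1 := wdist_triangle q (x ^ m * q) (x ^ m * p)
      have t2 := wdist_triangle p q (x ^ m * p)
      rw [wdist_mul_left] at t1
      unfold IsBetween; linarith
    have hyb : IsBetween p (y * p) (x ^ m * p) := by
      have e1 : wdist (y * p) (y ^ m * p) = wdist p (y ^ m * p) - wdist p (y * p) := by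
        obtain ⟨k, rfl⟩ := Nat.exists_eq_succ_of_ne_zero hm
        rw [hp.wdist_pow, Nat.succ_eq_add_one, pow_succ', mul_assoc, wdist_mul_left, hp.wdist_pow]
        push_cast; ring
      have hu := gromov_ultrametric p (y * p) (y ^ m * p) (x ^ m * p)
      rw [gromov_comm p (y ^ m * p)] at hu
      have h1 : gromov p (y * p) (y ^ m * p) = 2 * wdist p (y * p) := by
        unfold gromov; linarith
      have h2 : 2 * wdist p (y * p) ≤ gromov p (y * p) (x ^ m * p) := by
        rcases hu with hu | hu <;> linarith
      have t1 := wdist_triangle p (y * p) (x ^ m * p)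
      unfold gromov at h2
      unfold IsBetween; linarith
    have e1 := hyb.wdist_eq hqb h
    have t1 := wdist_triangle (y * p) q (x * (y * p))
    have t2 := wdist_triangle q (x * q) (x * (y * p))
    rw [wdist_mul_left, wdist_comm q (y * p)] at t2
    linarith

theorem exists_short_isAxisPoint_of_gromov_lt {y u Y p : FreeGroup α} (hy : y ≠ 1)
    (hp : IsAxisPoint y p) (huy : ¬ Commute u y)
    (hY : wdist p (Y * p) = 200 * wdist p (y * p))
    (hG : ∀ v z, (v = u ∨ v = u⁻¹) → (z = Y ∨ z = Y⁻¹) →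
      gromov p (v * p) (z * p) < 16 * wdist p (y * p))
    (hYy : Commute Y y) :
    ∃ q, IsAxisPoint ⁅Y, u⁆ q ∧
      2 * wdist p q + wdist p (y * p) + wdist p (u * p) ≤ wdist q (⁅Y, u⁆ * q) := by
  have hb := wdist_mul_self_pos hy p
  set b := wdist p (y * p) with hbdef
  have hYi : wdist p (Y⁻¹ * p) = 200 * b := by rw [wdist_inv_mul_self, hY]
  have key : ∀ v z e, (v = u ∨ v = u⁻¹) → (z = Y ∨ z = Y⁻¹) → 80 * b ≤ gromov p (z * p) e →
      gromov p (v⁻¹ * p) e < 16 * b ∧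
      ∀ z', (z' = Y ∨ z' = Y⁻¹) → gromov p (z' * p) (v * e) ≤ 44 * b := by
    intro v z e hv hz he
    have hv' : v⁻¹ = u ∨ v⁻¹ = u⁻¹ := by
      rcases hv with rfl | rfl <;> simp
    have h1 : gromov p (v⁻¹ * p) e < 16 * b := by
      have hu := gromov_ultrametric p (v⁻¹ * p) e (z * p)
      rw [gromov_comm p e] at hu
      have := hG _ _ hv' hz
      rcases hu with hu | hu <;> linarith
    refine ⟨h1, fun z' hz' => ?_⟩
    have hvD : wdist p (v * p) = wdist p (u * p) := by
      rcases hv with rfl | rfl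
      · rfl
      · exact wdist_inv_mul_self _ _
    rcases lt_or_ge (wdist p (u * p)) (16 * b) with hD | hD
    · have hvy : ¬ Commute v y := by
        rcases hv with rfl | rfl
        · exact huy
        · rwa [Commute.inv_left_iff]
      have hz'a : Commute z' y := by
        rcases hz' with rfl | rfl
        · exact hYy
        · exact hYy.inv_left
      have hza : Commute z y := by
        rcases hz with rfl | rfl
        · exact hYy
        · exact hYy.inv_left
      have := FollowsAxis.gromov_mul_le (B := 16 * b) hy hp hvy (by rw [hvD]; linarith)
        ⟨z * p, hp.mul_of_commute hza, by linarith⟩ (hp.mul_of_commute hz'a)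
      linarith
    · have h2 := gromov_mul_add p v e
      have hu := gromov_ultrametric p (z' * p) (v * e) (v * p)
      rw [gromov_comm p (v * e), gromov_comm p (z' * p) (v * p)] at hu
      have := hG _ _ hv hz'
      rcases hu with hu | hu <;> linarith
  have advance : ∀ z e, (z = Y ∨ z = Y⁻¹) →
      (∀ z', (z' = Y ∨ z' = Y⁻¹) → gromov p (z' * p) e ≤ 44 * b) →
      356 * b ≤ gromov p (z * p) (z * e) := by
    intro z e hz h
    have h1 := gromov_mul_add p z e
    have h2 := h z⁻¹ (by rcases hz with rfl | rfl <;> simp)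
    have h3 : wdist p (z * p) = 200 * b := by rcases hz with rfl | rfl <;> assumption
    linarith
  -- the image of `p` under the commutator
  have a1 : ∀ z', (z' = Y ∨ z' = Y⁻¹) → gromov p (z' * p) (u⁻¹ * p) ≤ 44 * b := by
    intro z' hz'
    have := hG u⁻¹ z' (by simp) hz'
    rw [gromov_comm] at this
    linarith
  have a2 := advance Y⁻¹ _ (by simp) a1
  obtain ⟨a3, a4⟩ := key u Y⁻¹ _ (by simp) (by simp) (by linarith : 80 * b ≤ _)
  have a5 := advance Y _ (by simp) a4
  -- the image of `p` under the inverse of the commutator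
  have b1 : 80 * b ≤ gromov p (Y⁻¹ * p) (Y⁻¹ * p) := by
    unfold gromov; rw [wdist_self, hYi]; linarith
  have b2 := (key u⁻¹ Y⁻¹ _ (by simp) (by simp) b1).2
  have b3 := advance Y _ (by simp) b2
  have b4 := (key u Y _ (by simp) (by simp) (by linarith : 80 * b ≤ _)).2 Y (by simp)
  have e1 : Y * (u * (Y⁻¹ * (u⁻¹ * p))) = ⁅Y, u⁆ * p := by
    simp [commutatorElement_def, mul_assoc]
  have e2 : u * (Y * (u⁻¹ * (Y⁻¹ * p))) = (⁅Y, u⁆)⁻¹ * p := by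
    simp [commutatorElement_def, mul_assoc]
  rw [e1] at a5
  rw [e2] at b4
  have hgg : gromov p ((⁅Y, u⁆)⁻¹ * p) (⁅Y, u⁆ * p) ≤ 44 * b := by
    have hu := gromov_ultrametric p ((⁅Y, u⁆)⁻¹ * p) (⁅Y, u⁆ * p) (Y * p)
    rw [gromov_comm p (⁅Y, u⁆ * p), gromov_comm p _ (Y * p)] at hu
    rcases hu with hu | hu <;> linarith
  obtain ⟨q, hq, hpq⟩ := exists_isAxisPoint ⁅Y, u⁆ p
  have q1 := hpq 1 one_ne_zero
  have q2 := hpq 2 two_ne_zero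
  simp only [pow_one, Nat.cast_one, one_mul] at q1
  have hg2 : wdist ((⁅Y, u⁆)⁻¹ * p) (⁅Y, u⁆ * p) = wdist p (⁅Y, u⁆ ^ 2 * p) := by
    rw [wdist_mul_right_eq, inv_inv, pow_two, mul_assoc]
  unfold gromov at hgg
  rw [hg2, wdist_inv_mul_self] at hgg
  -- lower bound for the displacement of `p`
  have f1 := a4 Y⁻¹ (by simp)
  have f2 : wdist (Y⁻¹ * p) (u * (Y⁻¹ * (u⁻¹ * p))) = wdist p (⁅Y, u⁆ * p) := by
    rw [wdist_mul_right_eq, inv_inv, e1]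
  have f3 : wdist (u⁻¹ * p) (Y⁻¹ * (u⁻¹ * p)) = wdist p (u * (Y⁻¹ * (u⁻¹ * p))) := by
    rw [wdist_mul_right_eq, inv_inv]
  have f4 : 0 ≤ wdist p (Y⁻¹ * (u⁻¹ * p)) := wdist_nonneg _ _
  unfold gromov at f1 a3
  rw [f2, hYi] at f1
  rw [f3, wdist_inv_mul_self] at a3
  push_cast at q2
  refine ⟨q, hq, ?_⟩
  linarith

omit [DecidableEq α] in
theorem exists_min_on_orbit (y p : FreeGroup α) (φ : FreeGroup α → ℤ) (h0 : ∀ g, 0 ≤ φ g) :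
    ∃ j : ℤ, ∀ k : ℤ, φ (y ^ j * p) ≤ φ (y ^ k * (y ^ j * p)) := by
  let ψ : ℤ → ℕ := fun k => (φ (y ^ k * p)).toNat
  refine ⟨Function.argmin ψ, fun k => ?_⟩
  have h1 := Function.argmin_le ψ (k + Function.argmin ψ)
  rw [← mul_assoc, ← zpow_add]
  have h2 := h0 (y ^ (k + Function.argmin ψ) * p)
  have h3 : ψ (Function.argmin ψ) = (φ (y ^ (Function.argmin ψ) * p)).toNat := rfl
  have h4 : ψ (k + Function.argmin ψ) = (φ (y ^ (k + Function.argmin ψ) * p)).toNat := rfl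
  omega

omit [DecidableEq α] in
theorem commute_of_commute_pow {a b : FreeGroup α} {n : ℕ} (hn : n ≠ 0)
    (h : Commute a (b ^ n)) : Commute a b :=
  commute_of_commute_zpow (n := n) (Nat.cast_ne_zero.mpr hn) (by rwa [zpow_natCast])

theorem exists_short_isAxisPoint_of_le {x y p₁ p₂ : FreeGroup α} {m : ℕ} (hm : m = 200) (hxy : ¬ Commute x y)
    (h₁ : IsAxisPoint x p₁) (h₂ : IsAxisPoint y p₂)
    (hle : wdist p₁ (x * p₁) ≤ wdist p₂ (y * p₂)) :
    ∃ p, IsAxisPoint ⁅y ^ m, x ^ m⁆ p ∧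
      wdist p (x * p) ≤ wdist p (⁅y ^ m, x ^ m⁆ * p) ∧
      wdist p (y * p) ≤ wdist p (⁅y ^ m, x ^ m⁆ * p) := by
  have hm0 : m ≠ 0 := by omega
  have hm' : (m : ℤ) = 200 := by omega
  have hy : y ≠ 1 := by rintro rfl; exact hxy (Commute.one_right x)
  obtain ⟨j, hj⟩ := exists_min_on_orbit y p₂ (fun g => wdist g (x * g))
    (fun g => wdist_nonneg _ _)
  have hp := h₂.mul_of_commute ((Commute.refl y).zpow_left j)
  have hle' := hp.wdist_mul_self_eq h₂
  generalize y ^ j * p₂ = p at hp hj hle'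
  obtain ⟨q, hq, hpq⟩ := exists_isAxisPoint x p
  have hle'' : wdist q (x * q) ≤ wdist p (y * p) := by
    rw [h₁.wdist_mul_self_eq hq, ← hle']; exact hle
  have hG : ∀ v z, (v = x ^ m ∨ v = (x ^ m)⁻¹) → (z = y ^ m ∨ z = (y ^ m)⁻¹) →
      gromov p (v * p) (z * p) < 16 * wdist p (y * p) := by
    have hy' : y⁻¹ ≠ 1 := inv_ne_one.mpr hy
    have hpq' : ∀ n : ℕ, n ≠ 0 →
        wdist p (x⁻¹ ^ n * p) = 2 * wdist p q + n * wdist q (x⁻¹ * q) := by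
      intro n hn
      rw [inv_pow, wdist_inv_mul_self, wdist_inv_mul_self]; exact hpq n hn
    have m1 := hj 1
    have m2 := hj (-1)
    rw [zpow_one] at m1
    rw [zpow_neg_one] at m2
    rintro v z (rfl | rfl) (rfl | rfl)
    · exact gromov_pow_pow_lt hy hxy hp hq hpq hle'' m1 hm0
    · have := gromov_pow_pow_lt hy' (by rwa [Commute.inv_right_iff]) hp.inv hq hpq
        (by rwa [wdist_inv_mul_self]) m2 hm0
      rwa [inv_pow, wdist_inv_mul_self] at this
    · have := gromov_pow_pow_lt hy (by rwa [Commute.inv_left_iff]) hp hq.inv hpq'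
        (by rwa [wdist_inv_mul_self]) (by simpa only [wdist_inv_mul_self] using m1)
        hm0
      rwa [inv_pow] at this
    · have := gromov_pow_pow_lt hy' (by rwa [Commute.inv_left_iff, Commute.inv_right_iff]) hp.inv
        hq.inv hpq' (by simpa only [wdist_inv_mul_self] using hle'')
        (by simpa only [wdist_inv_mul_self] using m2) hm0
      rwa [inv_pow, inv_pow, wdist_inv_mul_self] at this
  have huy : ¬ Commute (x ^ m) y := fun h =>
    hxy (commute_of_commute_pow hm0 h.symm).symm
  obtain ⟨r, hr, hb⟩ := exists_short_isAxisPoint_of_gromov_lt (Y := y ^ m) hy hp huy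
    (by rw [hp.wdist_pow, hm']) hG (Commute.pow_self y m)
  refine ⟨r, hr, ?_, ?_⟩
  · have t1 := wdist_triangle r p (x * r)
    have t2 := wdist_triangle p (x * p) (x * r)
    rw [wdist_mul_left] at t2
    have c1 := wdist_comm r p
    have e1 := hpq 1 one_ne_zero
    have e2 := hpq m hm0
    have := wdist_nonneg q (x * q)
    have := wdist_nonneg p (y * p)
    simp only [pow_one, Nat.cast_one] at e1
    rw [hm'] at e2
    linarith
  · have t1 := wdist_triangle r p (y * r)
    have t2 := wdist_triangle p (y * p) (y * r)
    rw [wdist_mul_left] at t2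
    have c1 := wdist_comm r p
    have := wdist_nonneg p (x ^ m * p)
    linarith

theorem exists_short_isAxisPoint {x y : FreeGroup α} {m : ℕ} (hm : m = 200) (hxy : ¬ Commute x y) :
    ∃ p, IsAxisPoint ⁅y ^ m, x ^ m⁆ p ∧
      wdist p (x * p) ≤ wdist p (⁅y ^ m, x ^ m⁆ * p) ∧
      wdist p (y * p) ≤ wdist p (⁅y ^ m, x ^ m⁆ * p) := by
  obtain ⟨p₁, h₁, -⟩ := exists_isAxisPoint x 1
  obtain ⟨p₂, h₂, -⟩ := exists_isAxisPoint y 1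
  rcases le_total (wdist p₁ (x * p₁)) (wdist p₂ (y * p₂)) with h | h
  · exact exists_short_isAxisPoint_of_le hm hxy h₁ h₂ h
  · obtain ⟨p, hp, hy, hx⟩ := exists_short_isAxisPoint_of_le hm (fun h => hxy h.symm) h₂ h₁ h
    rw [← commutatorElement_inv (y ^ m)] at hp hx hy
    rw [wdist_inv_mul_self] at hx hy
    refine ⟨p, ?_, hx, hy⟩
    rw [← inv_inv ⁅y ^ m, x ^ m⁆]
    exact hp.inv

omit [DecidableEq α] in
theorem commutator_pow_pow_ne_one {x y : FreeGroup α} (hxy : ¬ Commute x y) {m : ℕ} (hm : m ≠ 0) :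
    ⁅y ^ m, x ^ m⁆ ≠ 1 := by
  rw [Ne, commutatorElement_eq_one_iff_commute]
  intro h
  exact hxy (commute_of_commute_pow hm (commute_of_commute_pow hm h).symm)

omit [DecidableEq α] in
theorem not_commute_commutator_pow_pow_right {x y : FreeGroup α} (hxy : ¬ Commute x y) {m : ℕ}
    (hm : m ≠ 0) : ¬ Commute ⁅y ^ m, x ^ m⁆ x := by
  intro h
  have hx : x ≠ 1 := by rintro rfl; exact hxy (Commute.one_left y)
  have h2 : Commute (y ^ m * x ^ m * (y ^ m)⁻¹) x := by
    have := h.mul_left (Commute.pow_self x m)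
    rwa [commutatorElement_def, inv_mul_cancel_right] at this
  have hxm : x ^ m ≠ 1 := by simpa [hm] using hx
  have h3 := commute_of_commute_conj hxm (h2.pow_right m)
  have h4 : Commute (y ^ m) x := commute_of_commute_pow hm h3
  exact hxy (commute_of_commute_pow hm h4.symm)

omit [DecidableEq α] in
theorem not_commute_commutator_pow_pow_left {x y : FreeGroup α} (hxy : ¬ Commute x y) {m : ℕ}
    (hm : m ≠ 0) : ¬ Commute ⁅y ^ m, x ^ m⁆ y := by
  intro h
  refine not_commute_commutator_pow_pow_right (fun h => hxy h.symm) hm (m := m) (x := y) (y := x) ?_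
  rw [← commutatorElement_inv]
  exact h.inv_left

end Short
end FreeGroup

namespace FreeGroup
section Chain

variable {α : Type*} [DecidableEq α]

/-- The product of `c ^ M * a` for `a` ranging over a list. -/
def chain {G : Type*} [Group G] (M : ℕ) (c : G) : List G → G
  | [] => 1
  | a :: l => c ^ M * a * chain M c l

theorem chain_cons {G : Type*} [Group G] (M : ℕ) (c a : G) (l : List G) :
    chain M c (a :: l) = c ^ M * a * chain M c l := rfl

/-- `a` does not commute with `c` and moves `p` at most as far as `c` does. -/
def IsShortFor (c p a : FreeGroup α) : Prop :=
  ¬ Commute a c ∧ wdist p (a * p) ≤ wdist p (c * p)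

theorem IsShortFor.inv {c p a : FreeGroup α} (h : IsShortFor c p a) : IsShortFor c p a⁻¹ := by
  refine ⟨by rw [Commute.inv_left_iff]; exact h.1, ?_⟩
  rw [wdist_inv_mul_self]; exact h.2

theorem IsShortFor.inv_base {c p a : FreeGroup α} (h : IsShortFor c p a) :
    IsShortFor c⁻¹ p a := by
  refine ⟨by rw [Commute.inv_right_iff]; exact h.1, ?_⟩
  rw [wdist_inv_mul_self]; exact h.2

/-- Every short letter moves `e` away from the axis of `c`. -/
def Diverges (c p e : FreeGroup α) : Prop :=
  ∀ a, IsShortFor c p a → ∀ f, IsAxisPoint c f → gromov p f (a * e) ≤ 14 * wdist p (c * p)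

theorem FollowsAxis.diverges {c p e : FreeGroup α} (hc : c ≠ 1) (hp : IsAxisPoint c p)
    (he : FollowsAxis c p (16 * wdist p (c * p)) e) : Diverges c p e := by
  intro a ha f hf
  have := FollowsAxis.gromov_mul_le hc hp ha.1 ha.2
    (he.imp fun _ h => ⟨h.1, by linarith [h.2]⟩) hf
  linarith

theorem diverges_self (c p : FreeGroup α) : Diverges c p p := by
  intro a ha f _
  have h1 := gromov_le_left p (a * p) f
  rw [gromov_comm] at h1
  have := ha.2
  have := wdist_nonneg p (c * p)
  linarith

theorem Diverges.le_gromov {c p e a : FreeGroup α} (hp : IsAxisPoint c p) (he : Diverges c p e)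
    (ha : IsShortFor c p a) (M : ℕ) :
    (2 * M - 14) * wdist p (c * p) ≤ gromov p (c ^ M * p) (c ^ M * (a * e)) := by
  have := hp.le_gromov_zpow_mul (he a ha) M
  simp only [zpow_natCast, Nat.abs_cast] at this
  linarith

theorem Diverges.followsAxis {c p e a : FreeGroup α} (hp : IsAxisPoint c p) (he : Diverges c p e)
    (ha : IsShortFor c p a) {M : ℕ} (hM : 15 ≤ M) :
    FollowsAxis c p (16 * wdist p (c * p)) (c ^ M * (a * e)) := by
  refine ⟨c ^ M * p, hp.mul_of_commute (Commute.pow_self c M), ?_⟩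
  have h1 := he.le_gromov hp ha M
  have h2 : (15 : ℤ) ≤ M := by exact_mod_cast hM
  have h3 := wdist_nonneg p (c * p)
  nlinarith

theorem Diverges.chain_mul {c p e : FreeGroup α} (hc : c ≠ 1) (hp : IsAxisPoint c p)
    (he : Diverges c p e) {M : ℕ} (hM : 15 ≤ M) (l : List (FreeGroup α))
    (hl : ∀ a ∈ l, IsShortFor c p a) : Diverges c p (chain M c l * e) := by
  induction l with
  | nil => simpa [chain] using he
  | cons a l ih =>
    have := (ih fun b hb => hl b (by simp [hb])).followsAxis hp (hl a (by simp)) hM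
    simpa [chain, mul_assoc] using this.diverges hc hp

theorem Diverges.le_gromov_chain {c p e : FreeGroup α} (hc : c ≠ 1) (hp : IsAxisPoint c p)
    (he : Diverges c p e) {M : ℕ} (hM : 15 ≤ M) {l : List (FreeGroup α)} (h0 : l ≠ [])
    (hl : ∀ a ∈ l, IsShortFor c p a) :
    (2 * M - 14) * wdist p (c * p) ≤ gromov p (c ^ M * p) (chain M c l * e) := by
  cases l with
  | nil => exact absurd rfl h0
  | cons a l =>
    have := (he.chain_mul hc hp hM l fun b hb => hl b (by simp [hb])).le_gromov hp
      (hl a (by simp)) M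
    simpa [chain, mul_assoc] using this

theorem wdist_chain_le {c p : FreeGroup α} (hp : IsAxisPoint c p) (M : ℕ)
    (l : List (FreeGroup α)) (hl : ∀ a ∈ l, IsShortFor c p a) :
    wdist p (chain M c l * p) ≤ l.length * (M + 1) * wdist p (c * p) := by
  induction l with
  | nil => simp [chain, wdist_self]
  | cons a l ih =>
    have h1 := ih fun b hb => hl b (by simp [hb])
    have h2 := (hl a (by simp)).2
    have h3 := hp.wdist_pow M
    have t1 := wdist_triangle p (c ^ M * p) (c ^ M * (a * (chain M c l * p)))
    have t2 := wdist_triangle p (a * p) (a * (chain M c l * p))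
    rw [wdist_mul_left] at t1 t2
    simp only [chain, mul_assoc, List.length_cons]
    push_cast
    nlinarith

/-- Two factorisations of the same element along a common axis agree up to elements of the
centraliser of `c`. -/
theorem commute_of_zpow_mul_eq {c d p q a b X Y z t : FreeGroup α} {k M : ℕ} (hc : c ≠ 1)
    (hd : d ≠ 1) (hcd : Commute c d) (hzc : Commute z c) (hp : IsAxisPoint c p)
    (hq : IsAxisPoint d q)
    (hle : wdist q (d * q) ≤ wdist p (c * p)) (hle' : wdist p (c * p) ≤ 2 * wdist q (d * q))
    (ha : IsShortFor c p a) (hb : IsShortFor d q b)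
    (hX : Diverges c p (X * t)) (hY : Diverges d q (Y * t)) (hM : 40 ≤ M)
    (hX' : (2 * M - 14) * wdist p (c * p) ≤ gromov p (c ^ M * p) (X * t))
    (hY' : (2 * M - 14) * wdist q (d * q) ≤ gromov q (d ^ M * q) (Y * t))
    (heq : c ^ k * a * X = z * (d ^ k * b * Y)) : Commute (X * Y⁻¹) c := by
  have hzd : Commute z d := commute_trans hc hzc hcd.symm
  have hMz : (40 : ℤ) ≤ M := by exact_mod_cast hM
  have hpos := wdist_mul_self_pos hd q
  have hO : wdist (c ^ k * p) (z * d ^ k * q) ≤ 7 * (wdist p (c * p) + wdist q (d * q)) := by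
    have h1 := hX a ha ((c ^ k)⁻¹ * (z * d ^ k * q)) (IsAxisPoint.of_commute hd hcd.symm
      (hq.mul_of_commute (hzd.mul_left (Commute.pow_self d k))) |>.mul_of_commute
        (Commute.pow_self c k).inv_left)
    have h2 := hY b hb ((z * d ^ k)⁻¹ * (c ^ k * p)) (IsAxisPoint.of_commute hc hcd
      (hp.mul_of_commute (Commute.pow_self c k)) |>.mul_of_commute
        (hzd.mul_left (Commute.pow_self d k)).inv_left)
    rw [← gromov_mul_left (c ^ k), mul_inv_cancel_left] at h1
    rw [← gromov_mul_left (z * d ^ k), mul_inv_cancel_left] at h2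
    have e : z * d ^ k * (b * (Y * t)) = c ^ k * (a * (X * t)) := by
      have := congrArg (· * t) heq
      simp only [mul_assoc] at this ⊢
      exact this.symm
    rw [e] at h2
    unfold gromov at h1 h2
    rw [wdist_comm (z * d ^ k * q) (c ^ k * p)] at h2
    linarith
  set G := c ^ k * a with hG
  set H := z * d ^ k * b with hH
  have hS : G * (X * t) = H * (Y * t) := by
    have := congrArg (· * t) heq
    simp only [hG, hH, mul_assoc] at this ⊢
    exact this
  have hGH : wdist (G * p) (H * q) ≤ 8 * (wdist p (c * p) + wdist q (d * q)) := by
    have t1 := wdist_triangle (G * p) (c ^ k * p) (H * q)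
    have t2 := wdist_triangle (c ^ k * p) (z * d ^ k * q) (H * q)
    have e1 : wdist (G * p) (c ^ k * p) = wdist p (a * p) := by
      rw [hG, mul_assoc, wdist_mul_left, wdist_comm]
    have e2 : wdist (z * d ^ k * q) (H * q) = wdist q (b * q) := by
      rw [hH, mul_assoc _ b, wdist_mul_left]
    have := ha.2
    have := hb.2
    linarith
  have hu : wdist (G * (c ^ M * p)) (G * (X * t)) ≤
      wdist (G * p) (G * (X * t)) - (M - 14) * wdist p (c * p) := by
    rw [wdist_mul_left, wdist_mul_left]
    unfold gromov at hX'
    rw [hp.wdist_pow] at hX'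
    linarith
  have hv : wdist (H * (d ^ M * q)) (G * (X * t)) ≤
      wdist (H * q) (G * (X * t)) - (M - 14) * wdist q (d * q) := by
    rw [hS, wdist_mul_left, wdist_mul_left]
    unfold gromov at hY'
    rw [hq.wdist_pow] at hY'
    linarith
  have hug : wdist (G * (c ^ M * p)) (G * p) = M * wdist p (c * p) := by
    rw [wdist_mul_left, wdist_comm, hp.wdist_pow]
  have hvh : wdist (H * (d ^ M * q)) (H * q) = M * wdist q (d * q) := by
    rw [wdist_mul_left, wdist_comm, hq.wdist_pow]
  have huv : wdist (G * (c ^ M * p)) (H * (d ^ M * q)) + 14 * (wdist p (c * p) + wdist q (d * q))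
      ≤ M * wdist p (c * p) + M * wdist q (d * q) := by
    have t1 := wdist_triangle (H * q) (G * p) (G * (X * t))
    have t2 := wdist_triangle (H * (d ^ M * q)) (H * q) (G * p)
    rw [wdist_comm (H * q) (G * p)] at t1 t2
    rcases wdist_four_point (G * (c ^ M * p)) (H * (d ^ M * q)) (G * p) (G * (X * t)) with h | h
    · nlinarith
    · nlinarith
  have hcomm : Commute (G * c * G⁻¹) (H * d * H⁻¹) := by
    refine commute_of_long_overlap (k := M) (l := M) (by simpa using hc) (hp.conj G)
      (hq.conj H) ?_
    rw [wdist_conj_mul, wdist_conj_mul, conj_pow, conj_pow]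
    simp only [mul_assoc, inv_mul_cancel_left, wdist_mul_left]
    rw [hp.wdist_pow, hq.wdist_pow]
    linarith
  have hz' : X * Y⁻¹ = G⁻¹ * H := by
    rw [mul_inv_eq_iff_eq_mul, mul_assoc, eq_inv_mul_iff_mul_eq]
    rw [heq, hH]; simp only [mul_assoc]
  have h1 : Commute c ((G⁻¹ * H) * d * (G⁻¹ * H)⁻¹) := by
    have h2 := (Commute.conj_iff G⁻¹).mpr hcomm
    have e1 : G⁻¹ * (G * c * G⁻¹) * G⁻¹⁻¹ = c := by group
    have e2 : G⁻¹ * (H * d * H⁻¹) * G⁻¹⁻¹ = G⁻¹ * H * d * (G⁻¹ * H)⁻¹ := by group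
    rwa [e1, e2] at h2
  rw [hz']
  have h2 := commute_of_commute_conj hd (commute_trans hc h1.symm hcd.symm)
  exact commute_trans hd h2 hcd


/-- The two-variable word, with the auxiliary element `c` left free. -/
def markedWord {G : Type*} [Group G] (N M : ℕ) (c x y : G) : G :=
  c ^ N * x * chain M c [x, x⁻¹, x⁻¹, y, y, y⁻¹, y⁻¹]

structure IsMarked (c p x y : FreeGroup α) : Prop where
  ne_one : c ≠ 1
  isAxisPoint : IsAxisPoint c p
  left : IsShortFor c p x
  right : IsShortFor c p y

variable {c p x y : FreeGroup α}

theorem IsMarked.le_gromov_markedWord (h : IsMarked c p x y) {N M : ℕ} (hM : 15 ≤ M) :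
    (2 * N - 14) * wdist p (c * p) ≤ gromov p (c ^ N * p) (markedWord N M c x y * p) := by
  have h1 : Diverges c p (chain M c [x, x⁻¹, x⁻¹, y, y, y⁻¹, y⁻¹] * p) :=
    (diverges_self c p).chain_mul h.ne_one h.isAxisPoint hM _
      (by simp [h.left, h.left.inv, h.right, h.right.inv])
  simpa [markedWord, mul_assoc] using h1.le_gromov h.isAxisPoint h.left N

theorem IsMarked.gromov_inv_markedWord_le (h : IsMarked c p x y) {N M : ℕ} (hM : 15 ≤ M)
    (hN : 15 ≤ N) {f : FreeGroup α} (hf : IsAxisPoint c f) :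
    gromov p f ((markedWord N M c x y)⁻¹ * p) ≤ 14 * wdist p (c * p) := by
  have hl := h.left.inv_base
  have hr := h.right.inv_base
  have hN' : (15 : ℤ) ≤ N := by exact_mod_cast hN
  have hpos := wdist_mul_self_pos h.ne_one p
  have h0 : FollowsAxis c⁻¹ p (16 * wdist p (c⁻¹ * p)) (c⁻¹ ^ N * p) := by
    refine ⟨c⁻¹ ^ N * p, h.isAxisPoint.inv.mul_of_commute (Commute.pow_self _ N), ?_⟩
    unfold gromov
    rw [wdist_self, h.isAxisPoint.inv.wdist_pow, wdist_inv_mul_self]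
    nlinarith
  have h1 := ((h0.diverges (inv_ne_one.mpr h.ne_one) h.isAxisPoint.inv).chain_mul
    (inv_ne_one.mpr h.ne_one) h.isAxisPoint.inv hM [y, y⁻¹, y⁻¹, x, x, x⁻¹, x⁻¹]
    (by simp [hl, hl.inv, hr, hr.inv])) y hr f (IsAxisPoint.of_commute h.ne_one
      (Commute.refl c).inv_right hf)
  rw [wdist_inv_mul_self] at h1
  have e : (markedWord N M c x y)⁻¹ * p =
      y * (chain M c⁻¹ [y, y⁻¹, y⁻¹, x, x, x⁻¹, x⁻¹] * (c⁻¹ ^ N * p)) := by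
    simp [markedWord, chain, mul_assoc]
  rwa [e]

theorem IsMarked.wdist_markedWord_le (h : IsMarked c p x y) (N M : ℕ) :
    wdist (c ^ N * p) (markedWord N M c x y * p) ≤ (7 * M + 8) * wdist p (c * p) := by
  have h1 := wdist_chain_le h.isAxisPoint M [x, x⁻¹, x⁻¹, y, y, y⁻¹, y⁻¹]
    (by simp [h.left, h.left.inv, h.right, h.right.inv])
  simp only [List.length_cons, List.length_nil] at h1
  push_cast at h1
  have e : markedWord N M c x y * p = c ^ N * (x * (chain M c [x, x⁻¹, x⁻¹, y, y, y⁻¹, y⁻¹] * p)) := by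
    simp only [markedWord, mul_assoc]
  rw [e, wdist_mul_left]
  have t1 := wdist_triangle p (x * p) (x * (chain M c [x, x⁻¹, x⁻¹, y, y, y⁻¹, y⁻¹] * p))
  rw [wdist_mul_left] at t1
  have := h.left.2
  linarith

end Chain
end FreeGroup

namespace FreeGroup
section Peel

variable {α : Type*} [DecidableEq α]

theorem IsMarked.gromov_markedWord_inv_le {c p x y : FreeGroup α} (h : IsMarked c p x y)
    {N M : ℕ} (hM : 15 ≤ M) (hN : 15 ≤ N) :
    gromov p (markedWord N M c x y * p) ((markedWord N M c x y)⁻¹ * p) ≤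
      14 * wdist p (c * p) := by
  have h1 := h.le_gromov_markedWord (N := N) hM
  have h2 := h.gromov_inv_markedWord_le hM hN
    (h.isAxisPoint.mul_of_commute (Commute.pow_self c N))
  have hN' : (15 : ℤ) ≤ N := by exact_mod_cast hN
  have hpos := wdist_mul_self_pos h.ne_one p
  rcases gromov_ultrametric p ((markedWord N M c x y)⁻¹ * p) (markedWord N M c x y * p)
    (c ^ N * p) with hu | hu
  · rw [gromov_comm, gromov_comm p _ (c ^ N * p)] at hu
    linarith
  · rw [gromov_comm p _ (c ^ N * p), gromov_comm p _ (c ^ N * p)] at hu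
    nlinarith

theorem two_mul_wdist_le_of_gromov_le {p q W : FreeGroup α} {E : ℤ}
    (h : gromov p (W * p) q ≤ E) (hW : E < wdist p (W * p))
    (h2 : wdist p q ≤ wdist (W⁻¹ * p) q) :
    2 * wdist p q ≤ wdist q (W * q) + E ∧ wdist p (W * p) ≤ wdist q (W * q) + E := by
  have e2 : wdist (W⁻¹ * p) q = wdist p (W * q) := by rw [wdist_mul_right_eq, inv_inv]
  have t := wdist_triangle (W * p) (W * q) q
  rw [wdist_mul_left, wdist_comm (W * q)] at t
  unfold gromov at h
  refine ⟨?_, by linarith⟩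
  rcases wdist_four_point p (W * q) q (W * p) with hf | hf
  · rw [wdist_mul_left, wdist_comm q p, wdist_comm q (W * p)] at hf
    linarith
  · rw [wdist_comm q (W * p), wdist_comm (W * q) q] at hf
    linarith

theorem commute_of_markedWord_eq {c d p q x y x' y' : FreeGroup α} (h : IsMarked c p x y)
    (h' : IsMarked d q x' y') {N M : ℕ} (hM : M = 100) (hN : N = 3000)
    (hW : markedWord N M c x y = markedWord N M d x' y')
    (hle : wdist q (d * q) ≤ wdist p (c * p))
    (hmin₁ : wdist p q ≤ wdist (markedWord N M c x y * p) q)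
    (hmin₂ : wdist p q ≤ wdist ((markedWord N M c x y)⁻¹ * p) q) :
    Commute c d ∧ wdist p (c * p) ≤ 2 * wdist q (d * q) := by
  have hM' : (M : ℤ) = 100 := by omega
  have hN' : (N : ℤ) = 3000 := by omega
  have g := h.gromov_markedWord_inv_le (N := N) (M := M) (by omega) (by omega)
  have l1 := h.wdist_markedWord_le N M
  have l2 := h'.wdist_markedWord_le N M
  rw [← hW] at l2
  set W := markedWord N M c x y with hWdef
  have p1 := h.isAxisPoint.wdist_pow N
  have p2 := h'.isAxisPoint.wdist_pow N
  rw [hM'] at l1 l2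
  rw [hN'] at p1 p2
  have hpos := wdist_mul_self_pos h.ne_one p
  have hpos' := wdist_mul_self_pos h'.ne_one q
  have t1 := wdist_triangle p (W * p) (c ^ N * p)
  have t2 := wdist_triangle q (d ^ N * q) (W * q)
  rw [wdist_comm (W * p)] at t1
  have key : 2 * wdist p q ≤ wdist q (W * q) + 14 * wdist p (c * p) ∧
      wdist p (W * p) ≤ wdist q (W * q) + 14 * wdist p (c * p) := by
    rcases gromov_ultrametric p (W * p) q (W⁻¹ * p) with hu | hu
    · exact two_mul_wdist_le_of_gromov_le (hu.trans g) (by linarith) hmin₂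
    · have := two_mul_wdist_le_of_gromov_le (W := W⁻¹) (q := q) (p := p)
        (E := 14 * wdist p (c * p)) (by rw [gromov_comm]; exact hu.trans g)
        (by rw [wdist_inv_mul_self]; linarith) (by rw [inv_inv]; exact hmin₁)
      simpa only [wdist_inv_mul_self] using this
  refine ⟨commute_of_long_overlap h.ne_one h.isAxisPoint h'.isAxisPoint N N ?_, by linarith⟩
  rw [p1, p2]
  have t3 := wdist_triangle (c ^ N * p) (W * p) (d ^ N * q)
  have t4 := wdist_triangle (W * p) (W * q) (d ^ N * q)
  rw [wdist_mul_left, wdist_comm (W * q)] at t4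
  linarith

theorem exists_far_isAxisPoint {c d p q : FreeGroup α} (hc : c ≠ 1)
    (hcd : Commute c d) (hp : IsAxisPoint c p)
    (hle : wdist q (d * q) ≤ wdist p (c * p)) :
    ∃ t, FollowsAxis c p (16 * wdist p (c * p)) t ∧ FollowsAxis d q (16 * wdist q (d * q)) t := by
  have hpos := wdist_mul_self_pos hc p
  have h0 := wdist_nonneg p q
  have ht := hp.mul_of_commute ((Commute.refl c).zpow_left (8 + wdist p q))
  have hdist := hp.wdist_zpow (8 + wdist p q)
  rw [abs_of_nonneg (by linarith)] at hdist
  refine ⟨c ^ (8 + wdist p q) * p, ⟨_, ht, ?_⟩, ⟨_, ht.of_commute hc hcd, ?_⟩⟩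
  · unfold gromov
    rw [wdist_self, hdist]
    nlinarith
  · have t1 := wdist_triangle p q (c ^ (8 + wdist p q) * p)
    unfold gromov
    rw [wdist_self]
    nlinarith

theorem IsMarked.peel {c d p q x y x' y' a b z : FreeGroup α} (h : IsMarked c p x y)
    (h' : IsMarked d q x' y') {M k : ℕ} (hM : 40 ≤ M) (hcd : Commute c d)
    (hle : wdist q (d * q) ≤ wdist p (c * p)) (hle' : wdist p (c * p) ≤ 2 * wdist q (d * q))
    (hz : Commute z c) {l l' : List (FreeGroup α)} (h0 : l ≠ []) (h0' : l' ≠ [])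
    (ha : IsShortFor c p a) (hb : IsShortFor d q b)
    (hl : ∀ a ∈ l, IsShortFor c p a) (hl' : ∀ a ∈ l', IsShortFor d q a)
    (heq : c ^ k * a * chain M c l = z * (d ^ k * b * chain M d l')) :
    ∃ z', Commute z' c ∧ chain M c l = z' * chain M d l' ∧ c ^ k * a * z' = z * (d ^ k * b) := by
  obtain ⟨t, ht, ht'⟩ := exists_far_isAxisPoint h.ne_one hcd h.isAxisPoint hle
  have D := ht.diverges h.ne_one h.isAxisPoint
  have D' := ht'.diverges h'.ne_one h'.isAxisPoint
  refine ⟨chain M c l * (chain M d l')⁻¹, ?_, by group, ?_⟩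
  · exact commute_of_zpow_mul_eq h.ne_one h'.ne_one hcd hz h.isAxisPoint h'.isAxisPoint hle hle'
      ha hb (D.chain_mul h.ne_one h.isAxisPoint (by omega) l hl)
      (D'.chain_mul h'.ne_one h'.isAxisPoint (by omega) l' hl') hM
      (D.le_gromov_chain h.ne_one h.isAxisPoint (by omega) h0 hl)
      (D'.le_gromov_chain h'.ne_one h'.isAxisPoint (by omega) h0' hl') heq
  · rw [← mul_assoc, heq]; group

omit [DecidableEq α] in
theorem eq_of_mul_mul_eq_mul_mul {c x ζ ζ' z z' : FreeGroup α} (hc : c ≠ 1) (hx : ¬ Commute x c)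
    (h1 : Commute ζ c) (h2 : Commute ζ' c) (h3 : Commute z c) (h4 : Commute z' c)
    (h : ζ * x * z = ζ' * x * z') : ζ = ζ' ∧ z = z' := by
  have key : ζ'⁻¹ * ζ = 1 := by
    by_contra hu
    have e : x⁻¹ * (ζ'⁻¹ * ζ) * x⁻¹⁻¹ = z' * z⁻¹ := by
      rw [inv_inv, mul_assoc, inv_mul_eq_iff_eq_mul, mul_assoc, inv_mul_eq_iff_eq_mul,
        eq_mul_inv_of_mul_eq h]
      simp only [mul_assoc]
    have hu' : Commute (ζ'⁻¹ * ζ) c := h2.inv_left.mul_left h1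
    have h5 : Commute x⁻¹ (ζ'⁻¹ * ζ) := by
      refine commute_of_commute_conj hu ?_
      rw [e]
      exact commute_trans hc (h4.mul_left h3.inv_left) hu'
    rw [Commute.inv_left_iff] at h5
    exact hx (commute_trans hu h5 hu'.symm)
  have e : ζ = ζ' := (inv_mul_eq_one.mp key).symm
  subst e
  exact ⟨rfl, by simpa [mul_assoc] using h⟩

theorem IsMarked.eq_of_commute {c d p q x y x' y' : FreeGroup α} (h : IsMarked c p x y)
    (h' : IsMarked d q x' y') {N M : ℕ} (hM : 40 ≤ M) (hcd : Commute c d)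
    (hle : wdist q (d * q) ≤ wdist p (c * p)) (hle' : wdist p (c * p) ≤ 2 * wdist q (d * q))
    (heq : markedWord N M c x y = markedWord N M d x' y') : c = d ∧ x = x' ∧ y = y' := by
  have hx := h.left
  have hy := h.right
  have hx' := h'.left
  have hy' := h'.right
  have hxi := hx.inv
  have hyi := hy.inv
  have hxi' := hx'.inv
  have hyi' := hy'.inv
  have hdc := hcd.symm
  obtain ⟨z₁, c₁, e₁, f₁⟩ := h.peel h' (k := N) (z := 1) (a := x) (b := x')
    (l := [x, x⁻¹, x⁻¹, y, y, y⁻¹, y⁻¹]) (l' := [x', x'⁻¹, x'⁻¹, y', y', y'⁻¹, y'⁻¹])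
    hM hcd hle hle' (Commute.one_left c)
    (by simp) (by simp) hx hx' (by simp [*]) (by simp [*]) (by rw [one_mul]; exact heq)
  rw [chain_cons M c, chain_cons M d] at e₁
  obtain ⟨z₂, c₂, e₂, f₂⟩ := h.peel h' hM hcd hle hle' c₁
    (by simp) (by simp) hx hx' (by simp [*]) (by simp [*]) e₁
  rw [chain_cons M c, chain_cons M d] at e₂
  obtain ⟨z₃, c₃, e₃, f₃⟩ := h.peel h' hM hcd hle hle' c₂
    (by simp) (by simp) hxi hxi' (by simp [*]) (by simp [*]) e₂
  rw [chain_cons M c, chain_cons M d] at e₃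
  obtain ⟨z₄, c₄, e₄, f₄⟩ := h.peel h' hM hcd hle hle' c₃
    (by simp) (by simp) hxi hxi' (by simp [*]) (by simp [*]) e₃
  rw [chain_cons M c, chain_cons M d] at e₄
  obtain ⟨z₅, c₅, e₅, f₅⟩ := h.peel h' hM hcd hle hle' c₄
    (by simp) (by simp) hy hy' (by simp [*]) (by simp [*]) e₄
  rw [chain_cons M c, chain_cons M d] at e₅
  obtain ⟨z₆, c₆, -, f₆⟩ := h.peel h' hM hcd hle hle' c₅
    (by simp) (by simp) hy hy' (by simp [*]) (by simp [*]) e₅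
  clear e₁ e₂ e₃ e₄ e₅ heq
  have comm : ∀ {u v : FreeGroup α}, Commute u c → Commute v c → Commute u v :=
    fun hu hv => commute_trans h.ne_one hu hv
  have hcM := Commute.pow_self c M
  have hcN := Commute.pow_self c N
  have hdM := hdc.pow_left M
  have hdN := hdc.pow_left N
  obtain ⟨g₁, g₂⟩ := eq_of_mul_mul_eq_mul_mul (x := x) (ζ := (d ^ N)⁻¹ * c ^ N) (z := z₁)
    (ζ' := (d ^ M)⁻¹ * z₁⁻¹ * c ^ M) (z' := z₂) h.ne_one hx.1 (hdN.inv_left.mul_left hcN)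
    ((hdM.inv_left.mul_left c₁.inv_left).mul_left hcM) c₁ c₂ (by
      trans x'
      · rw [mul_assoc, mul_assoc, ← mul_assoc (c ^ N), f₁]; group
      · rw [mul_assoc _ _ x, mul_assoc _ _ z₂, f₂]; group)
  obtain ⟨g₃, g₄⟩ := eq_of_mul_mul_eq_mul_mul (x := x) (ζ := (d ^ N)⁻¹ * c ^ N) (z := z₁)
    (ζ' := z₃⁻¹) (z' := (c ^ M)⁻¹ * z₂ * d ^ M) h.ne_one hx.1 (hdN.inv_left.mul_left hcN)
    c₃.inv_left c₁ ((hcM.inv_left.mul_left c₂).mul_left hdM) (by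
      trans x'
      · rw [mul_assoc, mul_assoc, ← mul_assoc (c ^ N), f₁]; group
      · rw [← inv_inj]
        have : x'⁻¹ = (d ^ M)⁻¹ * z₂⁻¹ * (c ^ M * x⁻¹ * z₃) := by rw [f₃]; group
        rw [this]; group)
  subst g₂
  have hcd' : c = d := by
    have h1 : c ^ M = d ^ M := by
      rw [mul_assoc, eq_inv_mul_iff_mul_eq, (comm hcM c₁).eq] at g₄
      exact mul_left_cancel g₄
    have hM0 : (M : ℤ) ≠ 0 := by omega
    exact zpow_left_inj_of_ne hM0 (by rw [zpow_natCast, zpow_natCast]; exact h1)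
  subst hcd'
  have k₁ : z₁ = 1 := by
    have h1 := c₁.inv_left.pow_right M
    rw [inv_mul_cancel, mul_assoc, h1.eq, inv_mul_cancel_left] at g₁
    exact inv_eq_one.mp g₁.symm
  have k₃ : z₃ = 1 := by
    rw [inv_mul_cancel] at g₃
    exact inv_eq_one.mp g₃.symm
  subst k₁ k₃
  simp only [one_mul, mul_one, mul_right_inj] at f₁
  subst f₁
  simp only [one_mul, mul_eq_left] at f₄
  subst f₄
  rw [one_mul, mul_assoc, mul_right_inj] at f₅
  subst f₅
  obtain ⟨k₅, -⟩ := eq_of_mul_mul_eq_mul_mul (x := y) (ζ := 1) (z := z₆) (ζ' := z₅) (z' := z₅)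
    h.ne_one hy.1 (Commute.one_left c) c₅ c₆ c₅ (by
      rw [← mul_assoc, (c₅.pow_right M).eq, mul_assoc, mul_assoc, mul_right_inj] at f₆
      rw [one_mul, f₆, mul_assoc])
  subst k₅
  exact ⟨rfl, rfl, (mul_one y).symm⟩

/-- The auxiliary element of the two-variable word. -/
def powCommutator {G : Type*} [Group G] (m : ℕ) (x y : G) : G :=
  y ^ m * x ^ m * (y ^ m)⁻¹ * (x ^ m)⁻¹

/-- The two-variable word. -/
def pairWord {G : Type*} [Group G] (x y : G) : G :=
  markedWord 3000 100 (powCommutator 200 x y) x y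

theorem map_chain {G H : Type*} [Group G] [Group H] (f : G →* H) (M : ℕ) (c : G) (l : List G) :
    f (chain M c l) = chain M (f c) (l.map f) := by
  induction l with
  | nil => simp [chain]
  | cons a l ih => simp [chain, ih]

theorem map_markedWord {G H : Type*} [Group G] [Group H] (f : G →* H) (N M : ℕ) (c x y : G) :
    f (markedWord N M c x y) = markedWord N M (f c) (f x) (f y) := by
  simp [markedWord, map_chain]

theorem map_pairWord {G H : Type*} [Group G] [Group H] (f : G →* H) (x y : G) :
    f (pairWord x y) = pairWord (f x) (f y) := by
  simp [pairWord, map_markedWord, powCommutator]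

theorem pairWord_eq_one_of_commute {G : Type*} [Group G] {x y : G} (h : Commute x y) :
    pairWord x y = 1 := by
  have hc : powCommutator 200 x y = 1 := by
    have := (h.symm.pow_pow 200 200).eq
    rw [powCommutator, this, mul_inv_cancel_right, mul_inv_cancel]
  simp [pairWord, markedWord, chain, hc]

theorem pairWord_conj {G : Type*} [Group G] (g x y : G) :
    pairWord (g * x * g⁻¹) (g * y * g⁻¹) = g * pairWord x y * g⁻¹ :=
  (map_pairWord (MulAut.conj g).toMonoidHom x y).symm

theorem exists_isMarked {x y : FreeGroup α} {m : ℕ} (hm : m = 200) (h : ¬ Commute x y) :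
    ∃ p, IsMarked (powCommutator m x y) p x y := by
  have hm0 : m ≠ 0 := by omega
  obtain ⟨p, hp, hx, hy⟩ := exists_short_isAxisPoint hm h
  exact ⟨p, commutator_pow_pow_ne_one h hm0, hp,
    ⟨fun h' => not_commute_commutator_pow_pow_right h hm0 h'.symm, hx⟩,
    ⟨fun h' => not_commute_commutator_pow_pow_left h hm0 h'.symm, hy⟩⟩

theorem pairWord_ne_one {x y : FreeGroup α} (h : ¬ Commute x y) : pairWord x y ≠ 1 := by
  obtain ⟨p, hp⟩ := exists_isMarked rfl h
  intro h1
  have h2 := hp.le_gromov_markedWord (N := 3000) (M := 100) (by norm_num)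
  have h3 := gromov_le_left p (markedWord 3000 100 (powCommutator 200 x y) x y * p)
    (powCommutator 200 x y ^ 3000 * p)
  have h4 := wdist_mul_self_pos hp.ne_one p
  rw [pairWord] at h1
  rw [gromov_comm, h1, one_mul, wdist_self] at h3
  rw [h1, one_mul] at h2
  push_cast at h2
  linarith

end Peel
end FreeGroup

namespace FreeGroup
section TwoVariables

variable {α : Type*} [DecidableEq α]

theorem IsShortFor.conj {c p a : FreeGroup α} (h : IsShortFor c p a) (g : FreeGroup α) :
    IsShortFor (g * c * g⁻¹) (g * p) (g * a * g⁻¹) := by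
  refine ⟨fun h' => h.1 ((Commute.conj_iff g).mp h'), ?_⟩
  rw [wdist_conj_mul, wdist_conj_mul]
  exact h.2

theorem IsMarked.conj {c p x y : FreeGroup α} (h : IsMarked c p x y) (g : FreeGroup α) :
    IsMarked (g * c * g⁻¹) (g * p) (g * x * g⁻¹) (g * y * g⁻¹) :=
  ⟨by simpa using h.ne_one, h.isAxisPoint.conj g, h.left.conj g, h.right.conj g⟩

omit [DecidableEq α] in
theorem markedWord_conj {G : Type*} [Group G] (N M : ℕ) (g c x y : G) :
    markedWord N M (g * c * g⁻¹) (g * x * g⁻¹) (g * y * g⁻¹) = g * markedWord N M c x y * g⁻¹ :=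
  (map_markedWord (MulAut.conj g).toMonoidHom N M c x y).symm

theorem IsMarked.exists_conj {c d p q x y x' y' : FreeGroup α} (h : IsMarked c p x y)
    (h' : IsMarked d q x' y') {N M : ℕ} (hM : M = 100) (hN : N = 3000)
    (hW : markedWord N M c x y = markedWord N M d x' y')
    (hle : wdist q (d * q) ≤ wdist p (c * p)) :
    ∃ s : FreeGroup α, s * x * s⁻¹ = x' ∧ s * y * s⁻¹ = y' := by
  obtain ⟨j, hj⟩ := exists_min_on_orbit (markedWord N M c x y) p (fun g => wdist g q)
    (fun g => wdist_nonneg _ _)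
  have e : ∀ j : ℤ, markedWord N M c x y ^ j * markedWord N M c x y *
      (markedWord N M c x y ^ j)⁻¹ = markedWord N M c x y := fun j => by
    rw [((Commute.refl (markedWord N M c x y)).zpow_left j).eq, mul_inv_cancel_right]
  have hc := h.conj (markedWord N M c x y ^ j)
  have hW' := markedWord_conj N M (markedWord N M c x y ^ j) c x y
  rw [e] at hW'
  have hle' := hle
  rw [← wdist_conj_mul (markedWord N M c x y ^ j) c p] at hle'
  have m1 := hj 1
  have m2 := hj (-1)
  rw [zpow_one] at m1
  rw [zpow_neg_one] at m2
  obtain ⟨hcd, h2⟩ := commute_of_markedWord_eq hc h' hM hN (hW'.trans hW) hle'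
    (by rw [hW']; exact m1) (by rw [hW']; exact m2)
  obtain ⟨-, hx, hy⟩ := hc.eq_of_commute h' (by omega) hcd hle' h2 (hW'.trans hW)
  exact ⟨_, hx, hy⟩

omit [DecidableEq α] in
/-- The two-variable word is a C-test word. -/
theorem exists_conj_of_pairWord_eq {x y x' y' : FreeGroup α} (h : pairWord x y = pairWord x' y')
    (h1 : pairWord x y ≠ 1) : ∃ s : FreeGroup α, s * x * s⁻¹ = x' ∧ s * y * s⁻¹ = y' := by
  classical
  have hxy : ¬ Commute x y := fun hc => h1 (pairWord_eq_one_of_commute hc)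
  have hxy' : ¬ Commute x' y' := fun hc => h1 (h.trans (pairWord_eq_one_of_commute hc))
  obtain ⟨p, hp⟩ := exists_isMarked rfl hxy
  obtain ⟨q, hq⟩ := exists_isMarked rfl hxy'
  rcases le_total (wdist q (powCommutator 200 x' y' * q))
    (wdist p (powCommutator 200 x y * p)) with hle | hle
  · exact hp.exists_conj hq rfl rfl h hle
  · obtain ⟨s, hs, ht⟩ := hq.exists_conj hp rfl rfl h.symm hle
    exact ⟨s⁻¹, by rw [← hs]; group, by rw [← ht]; group⟩

end TwoVariables
end FreeGroup

namespace FreeGroup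
section Magnus

open Polynomial

variable {S : Type*}

/-- A square-zero matrix attached to each generator. -/
noncomputable def nilMatrix (s : S) : Matrix (Fin 2) (Fin 2) (MvPolynomial S ℤ) :=
  !![-MvPolynomial.X s, 1; -(MvPolynomial.X s * MvPolynomial.X s), MvPolynomial.X s]

theorem nilMatrix_mul_apply_zero (s : S) (Q : Matrix (Fin 2) (Fin 2) (MvPolynomial S ℤ))
    (j : Fin 2) : (nilMatrix s * Q) 0 j = Q 1 j - MvPolynomial.X s * Q 0 j := by
  rw [Matrix.mul_apply, Fin.sum_univ_two]
  simp [nilMatrix]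
  ring

theorem nilMatrix_mul_apply_one (s : S) (Q : Matrix (Fin 2) (Fin 2) (MvPolynomial S ℤ))
    (j : Fin 2) : (nilMatrix s * Q) 1 j = MvPolynomial.X s * (nilMatrix s * Q) 0 j := by
  rw [nilMatrix_mul_apply_zero, Matrix.mul_apply, Fin.sum_univ_two]
  simp [nilMatrix]
  ring

theorem nilMatrix_mul_self (s : S) : nilMatrix s * nilMatrix s = 0 := by
  have h : ∀ j, (nilMatrix s * nilMatrix s) 0 j = 0 := by
    intro j
    rw [nilMatrix_mul_apply_zero]
    fin_cases j <;> simp [nilMatrix]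
  ext1 i j
  fin_cases i
  · exact h j
  · exact (nilMatrix_mul_apply_one s _ j).trans (by rw [h, mul_zero]; rfl)

theorem nilMatrix_ne_zero (s : S) : nilMatrix s ≠ 0 := by
  intro h
  have := congrFun (congrFun h 0) 1
  simp [nilMatrix] at this

theorem nilMatrix_mul_nilMatrix_mul_ne_zero {r s : S} (hrs : r ≠ s)
    {Q : Matrix (Fin 2) (Fin 2) (MvPolynomial S ℤ)} (hQ : nilMatrix s * Q ≠ 0) :
    nilMatrix r * (nilMatrix s * Q) ≠ 0 := by
  intro h
  apply hQ
  have h0 : ∀ j, (nilMatrix s * Q) 0 j = 0 := by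
    intro j
    have h1 : (nilMatrix r * (nilMatrix s * Q)) 0 j = 0 := by rw [h]; rfl
    rw [nilMatrix_mul_apply_zero, nilMatrix_mul_apply_one, ← sub_mul] at h1
    have h3 : (MvPolynomial.X s - MvPolynomial.X r : MvPolynomial S ℤ) ≠ 0 := by
      rw [sub_ne_zero]
      exact fun he => hrs (MvPolynomial.X_injective he).symm
    exact (mul_eq_zero.mp h1).resolve_left h3
  ext1 i j
  fin_cases i
  · exact h0 j
  · exact (nilMatrix_mul_apply_one s _ j).trans (by rw [h0, mul_zero]; rfl)

theorem eq_zero_of_nsmul_eq_zero {n : ℕ} (hn : n ≠ 0)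
    {Q : Matrix (Fin 2) (Fin 2) (MvPolynomial S ℤ)} (h : n • Q = 0) : Q = 0 := by
  ext1 i j
  have h1 : n • Q i j = 0 := congrFun (congrFun h i) j
  rw [nsmul_eq_mul] at h1
  exact (mul_eq_zero.mp h1).resolve_left (Nat.cast_ne_zero.mpr hn)

/-- The unit `1 + X N` of a polynomial ring attached to a square-zero element `N`. -/
noncomputable def oneAddXMulC {A : Type*} [Ring A] (N : A) (hN : N * N = 0) : A[X]ˣ where
  val := 1 + X * C N
  inv := 1 + X * C (-N)
  val_inv := by
    have h : X * C N * (X * C N) = 0 := by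
      rw [mul_assoc, ← mul_assoc (C N), ← X_mul, mul_assoc, ← C_mul, hN, C_0, mul_zero, mul_zero]
    rw [C_neg, mul_neg, ← sub_eq_add_neg, mul_sub, mul_one, add_mul, one_mul, h]
    simp
  inv_val := by
    have h : X * C N * (X * C N) = 0 := by
      rw [mul_assoc, ← mul_assoc (C N), ← X_mul, mul_assoc, ← C_mul, hN, C_0, mul_zero, mul_zero]
    rw [C_neg, mul_neg, ← sub_eq_add_neg, sub_mul, one_mul, mul_add, mul_one, h]
    simp

/-- A Magnus-type representation of the free group. -/
noncomputable def magnus : FreeGroup S →* (Matrix (Fin 2) (Fin 2) (MvPolynomial S ℤ))[X]ˣ :=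
  lift fun s => oneAddXMulC (nilMatrix s) (nilMatrix_mul_self s)

/-- The sign of a letter. -/
def letterSign (b : Bool) : ℤ := cond b 1 (-1)

theorem magnus_letter (s : S) (b : Bool) :
    (magnus (mk [(s, b)])).val = 1 + X * C (letterSign b • nilMatrix s) := by
  cases b
  · have h : magnus (mk [(s, false)]) = (oneAddXMulC (nilMatrix s) (nilMatrix_mul_self s))⁻¹ := by
      rw [magnus, ← lift_apply_of (f := fun s => oneAddXMulC (nilMatrix s) (nilMatrix_mul_self s)),
        ← _root_.map_inv]
      rfl
    rw [h, letterSign, cond_false, neg_one_smul]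
    rfl
  · have h : magnus (mk [(s, true)]) = oneAddXMulC (nilMatrix s) (nilMatrix_mul_self s) :=
      lift_apply_of
    rw [h, letterSign, cond_true, one_smul]
    rfl

theorem mk_cons (a : S × Bool) (L : List (S × Bool)) : mk (a :: L) = mk [a] * mk L := by
  rw [mul_mk, List.singleton_append]

theorem coeff_magnus_cons_zero (s : S) (b : Bool) (L : List (S × Bool)) :
    (magnus (mk ((s, b) :: L))).val.coeff 0 = (magnus (mk L)).val.coeff 0 := by
  rw [mk_cons, _root_.map_mul, Units.val_mul, magnus_letter,
    add_mul, one_mul, mul_assoc, coeff_add, coeff_X_mul_zero, add_zero]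

theorem coeff_magnus_cons_succ (s : S) (b : Bool) (L : List (S × Bool)) (m : ℕ) :
    (magnus (mk ((s, b) :: L))).val.coeff (m + 1) = (magnus (mk L)).val.coeff (m + 1) +
      letterSign b • (nilMatrix s * (magnus (mk L)).val.coeff m) := by
  rw [mk_cons, _root_.map_mul, Units.val_mul, magnus_letter,
    add_mul, one_mul, mul_assoc, coeff_add, coeff_X_mul, coeff_C_mul, smul_mul_assoc]

theorem nilMatrix_mul_coeff_magnus_cons (s : S) (b : Bool) (L : List (S × Bool)) (m : ℕ) :
    nilMatrix s * (magnus (mk ((s, b) :: L))).val.coeff m =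
      nilMatrix s * (magnus (mk L)).val.coeff m := by
  cases m with
  | zero => rw [coeff_magnus_cons_zero]
  | succ m =>
    rw [coeff_magnus_cons_succ, mul_add, mul_smul_comm, ← mul_assoc, nilMatrix_mul_self,
      zero_mul, smul_zero, add_zero]

theorem exists_leadingCoeff_magnus (L : List (S × Bool)) :
    ∀ (s : S) (b : Bool), IsReduced ((s, b) :: L) → ∃ (D n : ℕ)
      (Q : Matrix (Fin 2) (Fin 2) (MvPolynomial S ℤ)), n ≠ 0 ∧ nilMatrix s * Q ≠ 0 ∧
      (∀ m, D + 1 < m → (magnus (mk ((s, b) :: L))).val.coeff m = 0) ∧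
      (magnus (mk ((s, b) :: L))).val.coeff (D + 1) =
        n • letterSign b • (nilMatrix s * Q) ∧
      nilMatrix s * (magnus (mk ((s, b) :: L))).val.coeff D = nilMatrix s * Q := by
  induction L with
  | nil =>
    intro s b _
    refine ⟨0, 1, 1, one_ne_zero, by simpa using nilMatrix_ne_zero s, ?_, ?_, ?_⟩
    · intro m hm
      obtain ⟨k, rfl⟩ : ∃ k, m = k + 1 + 1 := ⟨m - 2, by omega⟩
      rw [coeff_magnus_cons_succ]
      simp [← one_eq_mk, coeff_one]
    · rw [coeff_magnus_cons_succ]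
      simp [← one_eq_mk, coeff_one]
    · rw [coeff_magnus_cons_zero]
      simp [← one_eq_mk]
  | cons a L ih =>
    obtain ⟨s, c⟩ := a
    intro r b hr
    rw [IsReduced, List.isChain_cons_cons] at hr
    obtain ⟨D, n, Q, hn, hQ, h1, h2, h3⟩ := ih s c hr.2
    by_cases hrs : r = s
    · subst hrs
      obtain rfl : b = c := hr.1 rfl
      refine ⟨D, n + 1, Q, by omega, hQ, ?_, ?_, ?_⟩
      · intro m hm
        obtain ⟨k, rfl⟩ : ∃ k, m = k + 1 := ⟨m - 1, by omega⟩
        rw [coeff_magnus_cons_succ, h1 _ hm, zero_add]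
        obtain rfl | hk := eq_or_lt_of_le (show D + 1 ≤ k by omega)
        · rw [h2, mul_smul_comm, mul_smul_comm, ← mul_assoc, nilMatrix_mul_self, zero_mul,
            smul_zero, smul_zero, smul_zero]
        · rw [h1 _ hk, mul_zero, smul_zero]
      · rw [coeff_magnus_cons_succ, h2, h3, succ_nsmul]
      · rw [nilMatrix_mul_coeff_magnus_cons, h3]
    · refine ⟨D + 1, 1, (magnus (mk ((s, c) :: L))).val.coeff (D + 1), one_ne_zero, ?_, ?_, ?_, ?_⟩
      · rw [h2, mul_smul_comm, mul_smul_comm]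
        intro h
        have h4 := eq_zero_of_nsmul_eq_zero hn h
        refine nilMatrix_mul_nilMatrix_mul_ne_zero hrs hQ ?_
        cases c <;> simpa [letterSign] using h4
      · intro m hm
        obtain ⟨k, rfl⟩ : ∃ k, m = k + 1 := ⟨m - 1, by omega⟩
        rw [coeff_magnus_cons_succ, h1 _ (by omega), h1 _ (by omega), mul_zero, smul_zero, zero_add]
      · rw [coeff_magnus_cons_succ, h1 _ (by omega), zero_add, one_nsmul]
      · rw [nilMatrix_mul_coeff_magnus_cons]

theorem magnus_injective : Function.Injective (magnus (S := S)) := by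
  classical
  rw [injective_iff_map_eq_one]
  intro g hg
  by_contra hne
  obtain ⟨⟨s, b⟩, L, hL⟩ : ∃ a L, g.toWord = a :: L :=
    List.exists_cons_of_ne_nil (by simpa using hne)
  have hr : IsReduced ((s, b) :: L) := hL ▸ isReduced_toWord
  obtain ⟨D, n, Q, hn, hQ, -, h2, -⟩ := exists_leadingCoeff_magnus L s b hr
  rw [← hL, mk_toWord, hg, Units.val_one, coeff_one, if_neg (by omega)] at h2
  have h3 := eq_zero_of_nsmul_eq_zero hn h2.symm
  apply hQ
  cases b <;> simpa [letterSign] using h3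

end Magnus
end FreeGroup

namespace FreeGroup
section Filtration

open Polynomial

variable {S : Type*}

theorem exists_inv_eq_one_add_mul {R : Type*} [Ring R] {u : Rˣ} {p q : R}
    (h : u.val = 1 + p * q) : ∃ r, (u⁻¹).val = 1 + p * r := by
  refine ⟨-(q * (u⁻¹).val), ?_⟩
  have h1 : (1 + p * q) * (u⁻¹).val = 1 := by rw [← h, Units.mul_inv]
  rw [add_mul, one_mul] at h1
  rw [mul_neg, ← mul_assoc, ← sub_eq_add_neg, eq_sub_iff_add_eq, h1]

variable (S) in
/-- The elements of the free group whose Magnus representation is `1` modulo `X ^ k`. -/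
noncomputable def magnusFiltration (k : ℕ) : Subgroup (FreeGroup S) where
  carrier := {g | ∃ Q, (magnus g).val = 1 + X ^ k * Q}
  one_mem' := ⟨0, by rw [_root_.map_one, Units.val_one, mul_zero, add_zero]⟩
  mul_mem' := by
    rintro g h ⟨Q, hQ⟩ ⟨R, hR⟩
    refine ⟨Q * (magnus h).val + R, ?_⟩
    rw [_root_.map_mul, Units.val_mul, hQ, add_mul, one_mul, mul_add, ← mul_assoc, hR]
    abel
  inv_mem' := by
    rintro g ⟨Q, hQ⟩
    rw [Set.mem_ofPred_eq, _root_.map_inv]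
    exact exists_inv_eq_one_add_mul hQ

theorem coeff_zero_magnus (g : FreeGroup S) : (magnus g).val.coeff 0 = 1 := by
  classical
  rw [← mk_toWord (x := g)]
  induction g.toWord with
  | nil => rw [← one_eq_mk, _root_.map_one, Units.val_one, coeff_one_zero]
  | cons a L ih => exact (coeff_magnus_cons_zero a.1 a.2 L).trans ih

theorem mem_magnusFiltration_zero (g : FreeGroup S) : g ∈ magnusFiltration S 0 :=
  ⟨(magnus g).val - 1, by rw [pow_zero, one_mul, add_sub_cancel]⟩

theorem mem_magnusFiltration_one (g : FreeGroup S) : g ∈ magnusFiltration S 1 := by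
  refine ⟨((magnus g).val - 1).divX, ?_⟩
  have h := X_mul_divX_add ((magnus g).val - 1)
  rw [coeff_sub, coeff_zero_magnus, coeff_one_zero, sub_self, C_0, add_zero] at h
  rw [pow_one, h, add_sub_cancel]

instance (k : ℕ) : (magnusFiltration S k).Normal where
  conj_mem := by
    rintro g ⟨Q, hQ⟩ h
    refine ⟨(magnus h).val * Q * (magnus h)⁻¹.val, ?_⟩
    rw [_root_.map_mul, _root_.map_mul, _root_.map_inv, Units.val_mul, Units.val_mul, hQ, mul_add,
      add_mul, mul_one, Units.mul_inv, ← mul_assoc, ← X_pow_mul, mul_assoc, mul_assoc, mul_assoc]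

theorem commutator_mem_magnusFiltration {k : ℕ} {g : FreeGroup S} (hg : g ∈ magnusFiltration S k)
    (h : FreeGroup S) : g * h * (h * g)⁻¹ ∈ magnusFiltration S (k + 1) := by
  obtain ⟨Q, hQ⟩ := hg
  obtain ⟨R, hR⟩ := mem_magnusFiltration_one h
  rw [pow_one] at hR
  refine ⟨(Q * R - R * Q) * (magnus (h * g)⁻¹).val, ?_⟩
  have h1 : (magnus (g * h)).val = (magnus (h * g)).val + X ^ (k + 1) * (Q * R - R * Q) := by
    have e1 : X ^ k * Q * (X * R) = X ^ (k + 1) * (Q * R) := by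
      rw [pow_succ, mul_assoc, ← mul_assoc Q, ← X_mul]
      simp only [mul_assoc]
    have e2 : X * R * (X ^ k * Q) = X ^ (k + 1) * (R * Q) := by
      rw [pow_succ', mul_assoc, ← mul_assoc R, ← X_pow_mul]
      simp only [mul_assoc]
    rw [_root_.map_mul, _root_.map_mul, Units.val_mul, Units.val_mul, hQ, hR]
    simp only [add_mul, mul_add, one_mul, mul_one, mul_sub, e1, e2]
    abel
  rw [_root_.map_mul, Units.val_mul, h1, add_mul, ← Units.val_mul, ← _root_.map_mul,
    mul_inv_cancel, _root_.map_one, Units.val_one, mul_assoc]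

theorem magnus_pow_eq {k : ℕ} (hk : k ≠ 0) {g : FreeGroup S} {Q}
    (hQ : (magnus g).val = 1 + X ^ k * Q) (n : ℕ) :
    ∃ T, (magnus (g ^ n)).val = 1 + X ^ k * (n • Q + X * T) := by
  induction n with
  | zero => exact ⟨0, by simp⟩
  | succ n ih =>
    obtain ⟨T, hT⟩ := ih
    obtain ⟨j, rfl⟩ := Nat.exists_eq_succ_of_ne_zero hk
    refine ⟨T + X ^ j * (n • Q + X * T) * Q, ?_⟩
    have e : (n • Q + X * T) * (X ^ (j + 1) * Q) = X * (X ^ j * (n • Q + X * T) * Q) := by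
      rw [← mul_assoc, ← X_pow_mul, pow_succ']
      simp only [mul_assoc]
    rw [pow_succ, _root_.map_mul, Units.val_mul, hT, hQ, Nat.succ_eq_add_one, add_mul, one_mul,
      mul_add, mul_one, mul_assoc, e]
    simp only [mul_add, succ_nsmul]
    abel

theorem mem_magnusFiltration_of_pow_mem {n : ℕ} (hn : n ≠ 0) {g : FreeGroup S} (k : ℕ)
    (h : g ^ n ∈ magnusFiltration S k) : g ∈ magnusFiltration S k := by
  induction k with
  | zero => exact mem_magnusFiltration_zero g
  | succ k ih =>
    obtain rfl | hk := eq_or_ne k 0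
    · exact mem_magnusFiltration_one g
    obtain ⟨R, hR⟩ := h
    obtain ⟨Q, hQ⟩ := ih ⟨X * R, by rw [hR, pow_succ, mul_assoc]⟩
    obtain ⟨T, hT⟩ := magnus_pow_eq hk hQ n
    have h1 : (X : (Matrix (Fin 2) (Fin 2) (MvPolynomial S ℤ))[X]) ^ k * (n • Q + X * T) =
        X ^ k * (X * R) := by
      rw [← mul_assoc, ← pow_succ]
      exact add_left_cancel (hT.symm.trans hR)
    have h2 : n • Q.coeff 0 = 0 := by
      have := congrArg (fun P => P.coeff k) h1
      simpa [coeff_X_pow_mul'] using this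
    have h3 := X_mul_divX_add Q
    rw [eq_zero_of_nsmul_eq_zero hn h2, C_0, add_zero] at h3
    exact ⟨Q.divX, by rw [hQ, pow_succ, mul_assoc, h3]⟩

theorem mem_magnusFiltration_of_zpow_mem {n : ℤ} (hn : n ≠ 0) {g : FreeGroup S} {k : ℕ}
    (h : g ^ n ∈ magnusFiltration S k) : g ∈ magnusFiltration S k := by
  apply mem_magnusFiltration_of_pow_mem (Int.natAbs_ne_zero.mpr hn)
  obtain e | e := Int.natAbs_eq n
  · rwa [e, zpow_natCast] at h
  · rwa [e, zpow_neg, zpow_natCast, inv_mem_iff] at h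

theorem exists_notMem_magnusFiltration {g : FreeGroup S} (hg : g ≠ 1) :
    ∃ k, g ∈ magnusFiltration S k ∧ g ∉ magnusFiltration S (k + 1) := by
  classical
  have h : ∃ k, g ∉ magnusFiltration S k := by
    by_contra! h
    apply hg
    apply magnus_injective
    rw [_root_.map_one]
    ext1
    ext1 m
    obtain ⟨Q, hQ⟩ := h (m + 1)
    rw [hQ, coeff_add, coeff_X_pow_mul', if_neg (by omega), add_zero, Units.val_one]
  have h0 : Nat.find h ≠ 0 := fun h0 => (h0 ▸ Nat.find_spec h) (mem_magnusFiltration_zero g)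
  obtain ⟨k, hk⟩ := Nat.exists_eq_succ_of_ne_zero h0
  refine ⟨k, not_not.mp (Nat.find_min h (by omega)), ?_⟩
  have := Nat.find_spec h
  rwa [hk] at this

theorem pairWord_mem_magnusFiltration {k : ℕ} {g : FreeGroup S} (hg : g ∈ magnusFiltration S k)
    (h : FreeGroup S) : pairWord g h ∈ magnusFiltration S (k + 1) := by
  rw [← QuotientGroup.eq_one_iff]
  change QuotientGroup.mk' (magnusFiltration S (k + 1)) (pairWord g h) = 1
  rw [map_pairWord]
  apply pairWord_eq_one_of_commute
  rw [Commute, SemiconjBy, ← mul_inv_eq_one, ← _root_.map_mul, ← _root_.map_mul, ← _root_.map_inv,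
    ← _root_.map_mul]
  exact (QuotientGroup.eq_one_iff _).mpr (commutator_mem_magnusFiltration hg h)

theorem mem_magnusFiltration_of_commute {k : ℕ} {g h : FreeGroup S} (hg : g ∈ magnusFiltration S k)
    (hg1 : g ≠ 1) (hgh : Commute g h) : h ∈ magnusFiltration S k := by
  obtain ⟨i, j, hj, e⟩ := exists_zpow_eq_zpow hg1 hgh
  exact mem_magnusFiltration_of_zpow_mem hj (e ▸ zpow_mem hg i)

end Filtration
end FreeGroup

namespace FreeGroup
section Induction

variable {S : Type}

attribute [irreducible] pairWord

theorem eq_of_pairWord_eq {U X Y U' X' Y' : FreeGroup S} (hX : pairWord U X = pairWord U' X')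
    (hY : pairWord U Y = pairWord U' Y') (hXY : ¬Commute (pairWord U X) (pairWord U Y)) :
    U = U' ∧ X = X' ∧ Y = Y' := by
  have hP : pairWord U X ≠ 1 := fun h => hXY (by rw [h]; exact Commute.one_left _)
  have hQ : pairWord U Y ≠ 1 := fun h => hXY (by rw [h]; exact Commute.one_right _)
  have hU : U ≠ 1 := by
    rintro rfl
    exact hP (pairWord_eq_one_of_commute (Commute.one_left X))
  obtain ⟨s, hs1, hs2⟩ := exists_conj_of_pairWord_eq hX hP
  obtain ⟨t, ht1, ht2⟩ := exists_conj_of_pairWord_eq hY hQ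
  have hsP : Commute (pairWord U X) s := by
    have h := pairWord_conj s U X
    rw [hs1, hs2, ← hX, eq_mul_inv_iff_mul_eq] at h
    exact h
  have htQ : Commute (pairWord U Y) t := by
    have h := pairWord_conj t U Y
    rw [ht1, ht2, ← hY, eq_mul_inv_iff_mul_eq] at h
    exact h
  have hst : Commute (s⁻¹ * t) U := by
    have h := ht1.trans hs1.symm
    have h2 : s⁻¹ * (t * U * t⁻¹) * t = s⁻¹ * (s * U * s⁻¹) * t := by rw [h]
    rw [Commute, SemiconjBy]
    simpa [mul_assoc] using h2
  obtain ⟨k, hk, hk1⟩ := exists_notMem_magnusFiltration hU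
  have hs : s ∈ magnusFiltration S (k + 1) :=
    mem_magnusFiltration_of_commute (pairWord_mem_magnusFiltration hk X) hP hsP
  have ht : t ∈ magnusFiltration S (k + 1) :=
    mem_magnusFiltration_of_commute (pairWord_mem_magnusFiltration hk Y) hQ htQ
  have h1 : s⁻¹ * t = 1 := by
    by_contra h
    exact hk1 (mem_magnusFiltration_of_commute (mul_mem (inv_mem hs) ht) h hst)
  obtain rfl : s = t := inv_mul_eq_one.mp h1
  obtain rfl : s = 1 := by
    by_contra h
    exact hXY (commute_trans h hsP htQ)
  simp only [one_mul, inv_one, mul_one] at hs1 hs2 ht2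
  exact ⟨hs1, hs2, ht2⟩

theorem exists_conj_of_pairWord_pairWord_eq {U X Y U' X' Y' : FreeGroup S}
    (h : pairWord (pairWord U X) (pairWord U Y) = pairWord (pairWord U' X') (pairWord U' Y'))
    (h1 : pairWord (pairWord U X) (pairWord U Y) ≠ 1) :
    ∃ s, s * U * s⁻¹ = U' ∧ s * X * s⁻¹ = X' ∧ s * Y * s⁻¹ = Y' := by
  obtain ⟨s, hs1, hs2⟩ := exists_conj_of_pairWord_eq h h1
  rw [← pairWord_conj] at hs1 hs2
  refine ⟨s, eq_of_pairWord_eq hs1 hs2 fun hc => h1 ?_⟩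
  rw [h]
  rw [hs1, hs2] at hc
  exact pairWord_eq_one_of_commute hc

/-- The word on `n + 2` generators built from a word on `n + 1` generators. -/
def extendWord {n : ℕ} (w : FreeGroup (Fin (n + 1))) : FreeGroup (Fin (n + 2)) :=
  pairWord (pairWord (map Fin.castSucc w) (of (Fin.last _))) (pairWord (map Fin.castSucc w) (of 0))

/-- The C-test word on two generators. -/
def basePairWord : FreeGroup (Fin 2) := pairWord (of 0) (of 1)

/-- The iterated C-test word on `m + 2` generators. -/
def iteratedPairWord : (m : ℕ) → FreeGroup (Fin (m + 2))
  | 0 => basePairWord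
  | m + 1 => extendWord (iteratedPairWord m)

theorem map_iteratedPairWord_eq_one {G : Type*} [CommGroup G] (m : ℕ)
    (f : FreeGroup (Fin (m + 2)) →* G) : f (iteratedPairWord m) = 1 := by
  cases m with
  | zero => exact (map_pairWord _ _ _).trans (pairWord_eq_one_of_commute (Commute.all _ _))
  | succ m => exact (map_pairWord _ _ _).trans (pairWord_eq_one_of_commute (Commute.all _ _))

theorem not_commute_of {α : Type*} {u : FreeGroup α} (hu : u ≠ 1)
    (h : ∀ f : FreeGroup α →* Multiplicative ℤ, f u = 1) (a : α) : ¬Commute u (of a) := by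
  intro hc
  obtain ⟨i, j, hj, e⟩ := exists_zpow_eq_zpow hu hc
  have e1 := congrArg (lift fun _ => Multiplicative.ofAdd (1 : ℤ)) e
  rw [_root_.map_zpow, _root_.map_zpow, h, one_zpow, lift_apply_of, ← ofAdd_zsmul] at e1
  have e2 := congrArg Multiplicative.toAdd e1
  simp only [toAdd_one, toAdd_ofAdd, smul_eq_mul, mul_one] at e2
  exact hj e2.symm

theorem extendWord_ne_one {n : ℕ} {w : FreeGroup (Fin (n + 1))} (hw : w ≠ 1)
    (hwf : ∀ f : FreeGroup (Fin (n + 1)) →* Multiplicative ℤ, f w = 1) : extendWord w ≠ 1 := by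
  set U := map Fin.castSucc (w) with hU
  have hU1 : U ≠ 1 := by
    intro h
    exact hw (map_injective (Fin.castSucc_injective _) (h.trans (_root_.map_one _).symm))
  have hUf : ∀ f : FreeGroup (Fin (n + 2)) →* Multiplicative ℤ, f U = 1 := fun f =>
    hwf (f.comp (map Fin.castSucc))
  have hP := pairWord_ne_one (not_commute_of hU1 hUf (Fin.last _))
  have hQ := pairWord_ne_one (not_commute_of hU1 hUf 0)
  rw [extendWord, ← hU]
  refine pairWord_ne_one fun hc => ?_
  obtain ⟨i, j, hj, e⟩ := exists_zpow_eq_zpow hP hc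
  let r : FreeGroup (Fin (n + 2)) →* FreeGroup (Fin (n + 2)) :=
    lift (Fin.lastCases 1 fun i => of i.castSucc)
  have hr : r.comp (map Fin.castSucc) = map Fin.castSucc := by
    ext i
    simp [r]
  have hrU : r U = U := DFunLike.congr_fun hr (w)
  have hr1 : r (of (Fin.last _)) = 1 := by simp [r]
  have hr0 : r (of 0) = of 0 := by
    have h := DFunLike.congr_fun hr (of 0)
    rwa [MonoidHom.comp_apply, map.of, Fin.castSucc_zero] at h
  have e1 := congrArg r e
  rw [_root_.map_zpow, _root_.map_zpow, map_pairWord, map_pairWord, hrU, hr1, hr0,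
    pairWord_eq_one_of_commute (Commute.one_right U), one_zpow] at e1
  exact hQ (eq_one_of_zpow_eq_one hj e1.symm)

theorem iteratedPairWord_ne_one (m : ℕ) : iteratedPairWord m ≠ 1 := by
  induction m with
  | zero =>
    refine pairWord_ne_one fun h => ?_
    have h1 := h.eq
    revert h1
    decide
  | succ m ih => exact extendWord_ne_one ih (map_iteratedPairWord_eq_one m)

theorem lift_extendWord {n : ℕ} {w : FreeGroup (Fin (n + 1))} {A : Fin (n + 2) → FreeGroup S}
    {U X Y : FreeGroup S} (hU : lift (fun i => A i.castSucc) w = U) (hX : A (Fin.last _) = X)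
    (hY : A 0 = Y) : lift A (extendWord w) = pairWord (pairWord U X) (pairWord U Y) := by
  have h : (lift A).comp (map Fin.castSucc) = lift fun i => A i.castSucc := by
    ext i
    simp
  have h1 : lift A (map Fin.castSucc w) = U := (DFunLike.congr_fun h _).trans hU
  rw [extendWord, map_pairWord, map_pairWord, map_pairWord, h1, lift_apply_of, lift_apply_of, hX,
    hY]

theorem lift_basePairWord {A : Fin 2 → FreeGroup S} {X Y : FreeGroup S} (hX : A 0 = X)
    (hY : A 1 = Y) : lift A basePairWord = pairWord X Y := by
  rw [basePairWord, map_pairWord, lift_apply_of, lift_apply_of, hX, hY]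

theorem lift_conj {α G : Type*} [Group G] (A : α → G) (s : G) (w : FreeGroup α) :
    lift (fun i => s * A i * s⁻¹) w = s * lift A w * s⁻¹ := by
  have h : lift (fun i => s * A i * s⁻¹) = (MulAut.conj s).toMonoidHom.comp (lift A) := by
    ext i
    simp
  exact DFunLike.congr_fun h w

theorem exists_conj_of_lift_extendWord_eq {n : ℕ} {w : FreeGroup (Fin (n + 1))}
    (ih : ∀ A B : Fin (n + 1) → FreeGroup S, lift A w = lift B w → lift A w ≠ 1 →
      ∃ s, ∀ i, s * A i * s⁻¹ = B i) :
    ∀ A B : Fin (n + 2) → FreeGroup S, lift A (extendWord w) = lift B (extendWord w) →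
      lift A (extendWord w) ≠ 1 → ∃ s, ∀ i, s * A i * s⁻¹ = B i := by
  intro A B h h1
  obtain ⟨U, hU⟩ : ∃ U, lift (fun i => A i.castSucc) w = U := ⟨_, rfl⟩
  obtain ⟨V, hV⟩ : ∃ V, lift (fun i => B i.castSucc) w = V := ⟨_, rfl⟩
  obtain ⟨Y, hY⟩ : ∃ Y, B 0 = Y := ⟨_, rfl⟩
  rw [lift_extendWord hU rfl rfl] at h h1
  rw [lift_extendWord hV rfl hY] at h
  obtain ⟨s, hsU, hsX, hsY⟩ := exists_conj_of_pairWord_pairWord_eq h h1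
  rw [h] at h1
  have hc : ¬Commute V Y := by
    intro hc
    rw [pairWord_eq_one_of_commute hc] at h1
    exact h1 (pairWord_eq_one_of_commute (Commute.one_right _))
  rw [← hU, ← lift_conj] at hsU
  obtain ⟨r, hr⟩ := ih _ _ (hsU.trans hV.symm) (by
    rw [hsU]
    intro h2
    exact hc (h2 ▸ Commute.one_left _))
  obtain rfl : r = 1 := by
    by_contra hr1
    have h0 : Commute Y r := by
      have h2 := hr 0
      rw [Fin.castSucc_zero, hY, hsY, mul_inv_eq_iff_eq_mul] at h2
      exact h2.symm
    have hVr : Commute V r := by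
      have h2 := lift_conj (fun i => s * A (Fin.castSucc i) * s⁻¹) r w
      simp only [hr] at h2
      rw [hsU, hV, eq_mul_inv_iff_mul_eq] at h2
      exact h2
    exact hc (commute_trans hr1 hVr h0)
  refine ⟨s, fun i => ?_⟩
  induction i using Fin.lastCases with
  | last => exact hsX
  | cast i => simpa using hr i

theorem exists_conj_of_lift_basePairWord_eq (A B : Fin 2 → FreeGroup S)
    (h : lift A basePairWord = lift B basePairWord)
    (h1 : lift A basePairWord ≠ 1) : ∃ s, ∀ i, s * A i * s⁻¹ = B i := by
  obtain ⟨X, hX⟩ : ∃ X, A 0 = X := ⟨_, rfl⟩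
  obtain ⟨Y, hY⟩ : ∃ Y, A 1 = Y := ⟨_, rfl⟩
  obtain ⟨X', hX'⟩ : ∃ X', B 0 = X' := ⟨_, rfl⟩
  obtain ⟨Y', hY'⟩ : ∃ Y', B 1 = Y' := ⟨_, rfl⟩
  rw [lift_basePairWord hX hY] at h h1
  rw [lift_basePairWord hX' hY'] at h
  obtain ⟨s, hs0, hs1⟩ := exists_conj_of_pairWord_eq h h1
  exact ⟨s, Fin.forall_fin_two.mpr ⟨by rw [hX, hX', hs0], by rw [hY, hY', hs1]⟩⟩

theorem exists_conj_of_lift_iteratedPairWord_eq (m : ℕ) :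
    ∀ A B : Fin (m + 2) → FreeGroup S,
      lift A (iteratedPairWord m) = lift B (iteratedPairWord m) →
      lift A (iteratedPairWord m) ≠ 1 → ∃ s, ∀ i, s * A i * s⁻¹ = B i := by
  induction m with
  | zero =>
    rw [iteratedPairWord]
    exact exists_conj_of_lift_basePairWord_eq
  | succ m ih =>
    rw [iteratedPairWord]
    exact exists_conj_of_lift_extendWord_eq ih

end Induction

theorem norm_lt_norm_pow {α : Type*} [DecidableEq α] {g : FreeGroup α} (hg : g ≠ 1) {k : ℕ}
    (hk : 2 ≤ k) : norm g < norm (g ^ k) := by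
  obtain ⟨q, -, hq⟩ := exists_isAxisPoint g 1
  have h1 := hq 1 one_ne_zero
  have h2 := hq k (by omega)
  have h3 := wdist_mul_self_pos hg q
  have h4 : (2 : ℤ) ≤ k := by exact_mod_cast hk
  simp only [pow_one, mul_one, Nat.cast_one, one_mul] at h1 h2
  have h5 : wdist 1 g < wdist 1 (g ^ k) := by nlinarith
  simpa [wdist] using h5

end FreeGroup

open FreeGroup

theorem FreeGroup.exists_eq_pow_not_isProperPower {α : Type*} [DecidableEq α] (w : FreeGroup α)
    (hw : w ≠ 1) : ∃ (v : FreeGroup α) (k : ℕ), k ≠ 0 ∧ w = v ^ k ∧ ¬IsProperPower v := by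
  induction hn : norm w using Nat.strong_induction_on generalizing w with
  | _ n ih =>
    subst hn
    by_cases h : IsProperPower w
    · obtain ⟨u, k, hk, rfl⟩ := h
      have hu : u ≠ 1 := by
        rintro rfl
        exact hw (one_pow k)
      obtain ⟨v, l, hl, rfl, hv⟩ := ih _ (norm_lt_norm_pow hu hk) u hu rfl
      exact ⟨v, l * k, Nat.mul_ne_zero hl (by omega), (pow_mul v l k).symm, hv⟩
    · exact ⟨w, 1, one_ne_zero, (pow_one w).symm, h⟩

/-- (Ivanov) For every `n ≥ 2` there is a C-test word in `n` letters which is not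
a proper power. -/
theorem exists_cTestWord (n : ℕ) (hn : 2 ≤ n) :
    ∃ w : FreeGroup (Fin n),
      (∀ S : Type, Nontrivial S → IsCTestWord n w S) ∧ ¬ IsProperPower w := by
  obtain ⟨m, rfl⟩ := Nat.exists_eq_add_of_le' hn
  obtain ⟨v, k, hk, hv, hp⟩ :=
    exists_eq_pow_not_isProperPower (iteratedPairWord m) (iteratedPairWord_ne_one m)
  refine ⟨v, fun S _ => ⟨?_, fun A B h h1 => ?_⟩, hp⟩
  · rintro rfl
    exact iteratedPairWord_ne_one m (hv.trans (one_pow k))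
  · refine exists_conj_of_lift_iteratedPairWord_eq m A B ?_ ?_
    · rw [hv, _root_.map_pow, _root_.map_pow, h]
    · rw [hv, _root_.map_pow]
      intro h2
      exact h1 (eq_one_of_zpow_eq_one (Int.natCast_ne_zero.mpr hk) (by rwa [zpow_natCast]))
end
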